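/- arXiv:2508.02108 — 3 statements merged into one kernel-verified Lean document; each statement's English description precedes it below -/
import Mathlib

section
/- Let D be a 3-regular, 3-edge connected Hamiltonian-path digraph on {1, …, 2n} such that no 3-regular, 3-edge connected Hamiltonian-path digraph on {1, …, 2n} has strictly more source-to-sink paths than D. Then there is no index i with 1 ≤ i ≤ 2n − 2 such that the vertices i, i+1, i+2 all have outdegree at least 2, and there is no index i with 1 ≤ i ≤ 2n − 2 such that the vertices i, i+1, i+2 all have indegree at least 2. -/
/-- A finite directed multigraph with vertex set `Fin m` and edge set `Fin q`,
given by source and target maps. -/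
structure Multigraph (m q : ℕ) where
  src : Fin q → Fin m
  tgt : Fin q → Fin m

namespace Multigraph

variable {m q : ℕ}

/-- `p` is a directed path from `u` to `v`: a nonempty list of edges whose first edge
starts at `u`, whose last edge ends at `v`, and where consecutive edges are composable. -/
def IsPath (D : Multigraph m q) (u v : Fin m) (p : List (Fin q)) : Prop :=
  (∃ e rest, p = e :: rest ∧ D.src e = u) ∧
  (∃ e rest, p = rest ++ [e] ∧ D.tgt e = v) ∧
  p.Chain' (fun a b => D.tgt a = D.src b)

/-- The number of directed paths from `u` to `v` (paths counted as edge sequences). -/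
noncomputable def pathCount (D : Multigraph m q) (u v : Fin m) : ℕ :=
  Nat.card {p : List (Fin q) // D.IsPath u v p}

/-- `D` is acyclic: no vertex has a directed path to itself. -/
def Acyclic (D : Multigraph m q) : Prop :=
  ∀ v : Fin m, ¬ ∃ p, D.IsPath v v p

/-- In-degree of a vertex. -/
def indeg (D : Multigraph m q) (v : Fin m) : ℕ :=
  (Finset.univ.filter (fun e => D.tgt e = v)).card

/-- Out-degree of a vertex. -/
def outdeg (D : Multigraph m q) (v : Fin m) : ℕ :=
  (Finset.univ.filter (fun e => D.src e = v)).card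

/-- `D` is 3-regular: every vertex has total degree 3. -/
def ThreeRegular (D : Multigraph m q) : Prop :=
  ∀ v : Fin m, D.indeg v + D.outdeg v = 3

/-- `s` is the unique source (vertex of in-degree 0) of `D`. -/
def UniqueSource (D : Multigraph m q) (s : Fin m) : Prop :=
  D.indeg s = 0 ∧ ∀ v : Fin m, D.indeg v = 0 → v = s

/-- `t` is the unique sink (vertex of out-degree 0) of `D`. -/
def UniqueSink (D : Multigraph m q) (t : Fin m) : Prop :=
  D.outdeg t = 0 ∧ ∀ v : Fin m, D.outdeg v = 0 → v = t

/-- `μ_D(v)`: the number of directed paths from `s` to `v`, with `μ_D(s) = 1`. -/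
noncomputable def mu (D : Multigraph m q) (s v : Fin m) : ℕ :=
  if v = s then 1 else D.pathCount s v

/-- Two vertices are adjacent (disregarding orientation) via an edge in `S`. -/
def Adj (D : Multigraph m q) (S : Set (Fin q)) (a b : Fin m) : Prop :=
  ∃ e ∈ S, (D.src e = a ∧ D.tgt e = b) ∨ (D.src e = b ∧ D.tgt e = a)

/-- Weak connectivity using only the edges in `S`: any two distinct vertices are joined
by a finite sequence of edges of `S` traversed in either direction. -/
def WeaklyConnectedOn (D : Multigraph m q) (S : Set (Fin q)) : Prop :=
  ∀ a b : Fin m, a ≠ b → Relation.ReflTransGen (D.Adj S) a b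

/-- `D` is weakly connected. -/
def WeaklyConnected (D : Multigraph m q) : Prop :=
  D.WeaklyConnectedOn Set.univ

/-- `D` is `ℓ`-edge connected: it has at least two vertices, and deleting any set of at
most `ℓ - 1` edges leaves a weakly connected multigraph. -/
def EdgeConnected (D : Multigraph m q) (ℓ : ℕ) : Prop :=
  2 ≤ m ∧ ∀ F : Finset (Fin q), F.card ≤ ℓ - 1 → D.WeaklyConnectedOn {e | e ∉ F}

/-- `p` is a directed Hamiltonian path of `D` starting at `u`: a directed path that
visits every vertex exactly once. -/
def IsHamiltonianPath (D : Multigraph m q) (u : Fin m) (p : List (Fin q)) : Prop :=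
  (∃ v, D.IsPath u v p) ∧ (u :: p.map D.tgt).Nodup ∧
    ∀ w : Fin m, w ∈ u :: p.map D.tgt

/-- `D` contains a directed Hamiltonian path. -/
def HasHamiltonianPath (D : Multigraph m q) : Prop :=
  ∃ u p, D.IsHamiltonianPath u p

/-- `D` is simple: no two distinct edges have the same unordered pair of endpoints. -/
def Simple (D : Multigraph m q) : Prop :=
  ∀ e e' : Fin q, e ≠ e' →
    ¬ ((D.src e = D.src e' ∧ D.tgt e = D.tgt e') ∨
       (D.src e = D.tgt e' ∧ D.tgt e = D.src e'))

/-- `D` together with designated edges `H i` (from vertex `i` to vertex `i+1`, 0-based)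
is a Hamiltonian-path digraph: the designated edges are pairwise distinct, form the
Hamiltonian path, and every edge goes from a smaller vertex to a larger one.
(Vertices `0, …, m-1` here represent the vertices `1, …, m`.) -/
def IsHamPathDigraph (D : Multigraph m q) (H : Fin (m - 1) → Fin q) : Prop :=
  Function.Injective H ∧
  (∀ i : Fin (m - 1), (D.src (H i)).val = i.val ∧ (D.tgt (H i)).val = i.val + 1) ∧
  ∀ e : Fin q, (D.src e).val < (D.tgt e).val

end Multigraph

namespace Multigraph

variable {m q : ℕ}

/-- The number of edges of `D` whose endpoints receive different colours under `σ`. -/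
def cut (D : Multigraph m q) (σ : Fin m → Bool) : ℕ :=
  ∑ e, (σ (D.src e) ^^ σ (D.tgt e)).toNat

/-- Every non-constant two-colouring of the vertices is crossed by at least three edges. -/
def CutThree (D : Multigraph m q) : Prop :=
  ∀ σ : Fin m → Bool, (∃ x y, σ x ≠ σ y) → 3 ≤ D.cut σ

lemma cut_eq_card (D : Multigraph m q) (σ : Fin m → Bool) :
    D.cut σ = (Finset.univ.filter (fun e => σ (D.src e) ≠ σ (D.tgt e))).card := by
  rw [cut, Finset.card_filter]
  refine Finset.sum_congr rfl fun e _ => ?_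
  cases σ (D.src e) <;> cases σ (D.tgt e) <;> rfl

lemma EdgeConnected.cutThree {D : Multigraph m q} (h : D.EdgeConnected 3) : D.CutThree := by
  rintro σ ⟨x, y, hxy⟩
  by_contra! hlt
  rw [cut_eq_card] at hlt
  have hr := h.2 (Finset.univ.filter (fun e => σ (D.src e) ≠ σ (D.tgt e))) (by omega) x y
    (fun hx => hxy (by rw [hx]))
  have key : ∀ z, Relation.ReflTransGen
      (D.Adj {e | e ∉ Finset.univ.filter (fun e => σ (D.src e) ≠ σ (D.tgt e))}) x z →
      σ x = σ z := by
    intro z hz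
    induction hz with
    | refl => rfl
    | tail _ hbc ih =>
      obtain ⟨e, he, h1⟩ := hbc
      simp only [ne_eq, Finset.mem_filter, Finset.mem_univ, true_and, not_not,
        Set.mem_ofPred_eq] at he
      rcases h1 with ⟨h1, h2⟩ | ⟨h1, h2⟩
      · rw [ih, ← h1, ← h2, he]
      · rw [ih, ← h1, ← h2, he]
  exact hxy (key y hr)

lemma CutThree.edgeConnected {D : Multigraph m q} (hm : 2 ≤ m) (h : D.CutThree) :
    D.EdgeConnected 3 := by
  classical
  refine ⟨hm, fun F hF x y _ => ?_⟩
  by_contra hxy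
  let σ : Fin m → Bool := fun z => decide (Relation.ReflTransGen (D.Adj {e | e ∉ F}) x z)
  have h3 := h σ ⟨x, y, by simp [σ, hxy, Relation.ReflTransGen.refl]⟩
  rw [cut_eq_card] at h3
  have hsub : Finset.univ.filter (fun e => σ (D.src e) ≠ σ (D.tgt e)) ⊆ F := by
    intro e he
    by_contra heF
    simp only [ne_eq, Finset.mem_filter, Finset.mem_univ, true_and, σ, decide_eq_decide] at he
    exact he ⟨fun hs => hs.tail ⟨e, heF, Or.inl ⟨rfl, rfl⟩⟩,
      fun hs => hs.tail ⟨e, heF, Or.inr ⟨rfl, rfl⟩⟩⟩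
  have := Finset.card_le_card hsub
  omega

/-- `f` satisfies the recurrence of the number of directed paths starting at `s`. -/
def IsCount (D : Multigraph m q) (s : Fin m) (f : Fin m → ℕ) : Prop :=
  f s = 1 ∧ ∀ v, v ≠ s → f v = ∑ e with D.tgt e = v, f (D.src e)

lemma isPath_append_singleton (D : Multigraph m q) (s v : Fin m) (p : List (Fin q))
    (e : Fin q) : D.IsPath s v (p ++ [e]) ↔
      D.tgt e = v ∧ ((p = [] ∧ D.src e = s) ∨ D.IsPath s (D.src e) p) := by
  constructor
  · rintro ⟨⟨e1, r1, h1, hs⟩, ⟨e2, r2, h2, ht⟩, hc⟩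
    have h2' : p = r2 ∧ e = e2 := by simpa using List.append_inj' h2 rfl
    obtain ⟨rfl, rfl⟩ := h2'
    refine ⟨ht, ?_⟩
    rcases List.eq_nil_or_concat p with rfl | ⟨p', e', rfl⟩
    · left
      simp at h1
      exact ⟨rfl, by rw [h1.1, hs]⟩
    · right
      rw [List.concat_eq_append] at *
      have hc' := List.isChain_append.1 hc
      refine ⟨?_, ⟨e', p', rfl, ?_⟩, hc'.1⟩
      · rcases p' with _ | ⟨x, p'⟩
        · simp at h1
          exact ⟨e', [], rfl, by rw [h1.1, hs]⟩
        · simp at h1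
          exact ⟨x, p' ++ [e'], rfl, by rw [h1.1, hs]⟩
      · exact hc'.2.2 e' (by simp) e (by simp)
  · rintro ⟨ht, ⟨rfl, hs⟩ | ⟨⟨e1, r1, rfl, hs⟩, ⟨e2, r2, h2, ht2⟩, hc⟩⟩
    · exact ⟨⟨e, [], rfl, hs⟩, ⟨e, [], rfl, ht⟩, List.isChain_singleton _⟩
    · refine ⟨⟨e1, r1 ++ [e], rfl, hs⟩, ⟨e, _, rfl, ht⟩, ?_⟩
      refine List.isChain_append.2 ⟨hc, List.isChain_singleton _, ?_⟩
      intro x hx y hy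
      rw [h2] at hx
      simp at hx hy
      subst hx hy
      exact ht2

lemma IsPath.pairwise {D : Multigraph m q} (hlt : ∀ e, (D.src e).val < (D.tgt e).val)
    {s v : Fin m} {p : List (Fin q)} (h : D.IsPath s v p) :
    p.Pairwise (fun a b => D.src a < D.src b) := by
  have : Trans (fun a b : Fin q => D.src a < D.src b) (fun a b : Fin q => D.src a < D.src b)
      (fun a b : Fin q => D.src a < D.src b) := ⟨fun h1 h2 => lt_trans h1 h2⟩
  rw [← List.isChain_iff_pairwise]
  refine List.IsChain.imp ?_ h.2.2
  intro a b hab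
  rw [← hab]
  exact hlt a

lemma finite_path {D : Multigraph m q} (hlt : ∀ e, (D.src e).val < (D.tgt e).val)
    (s v : Fin m) : Finite {p : List (Fin q) // D.IsPath s v p} := by
  refine Finite.of_injective
    (β := {l : List (Fin q) // l.Nodup}) (fun p => ⟨p.1, (p.2.pairwise hlt).imp ?_⟩) ?_
  · rintro a b hab rfl
    exact lt_irrefl _ hab
  · intro p p' h
    simpa [Subtype.ext_iff] using h

lemma IsPath.lt {D : Multigraph m q} (hlt : ∀ e, (D.src e).val < (D.tgt e).val)
    {s v : Fin m} {p : List (Fin q)} (h : D.IsPath s v p) : s < v := by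
  induction p using List.reverseRecOn generalizing v with
  | nil =>
    obtain ⟨⟨e, r, h, _⟩, _⟩ := h
    simp at h
  | append_singleton p e ih =>
    rw [isPath_append_singleton] at h
    obtain ⟨rfl, ⟨_, rfl⟩ | h⟩ := h
    · exact hlt e
    · exact (ih h).trans (hlt e)

lemma isCount_mu {D : Multigraph m q} (hlt : ∀ e, (D.src e).val < (D.tgt e).val)
    (s : Fin m) : D.IsCount s (D.mu s) := by
  refine ⟨by simp [mu], fun v hv => ?_⟩
  have hfin : ∀ e, Finite {p : List (Fin q) //
      (p = [] ∧ D.src e = s) ∨ D.IsPath s (D.src e) p} := by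
    intro e
    have hf : {p : List (Fin q) | D.IsPath s (D.src e) p}.Finite :=
      Set.finite_coe_iff.1 (finite_path hlt s (D.src e))
    refine Set.Finite.to_subtype (s := {p | (p = [] ∧ D.src e = s) ∨ D.IsPath s (D.src e) p}) ?_
    refine Set.Finite.subset ((Set.finite_singleton []).union hf) ?_
    rintro p (⟨h, _⟩ | h)
    · exact Or.inl h
    · exact Or.inr h
  have hcard : ∀ e, Nat.card {p : List (Fin q) //
      (p = [] ∧ D.src e = s) ∨ D.IsPath s (D.src e) p} = D.mu s (D.src e) := by
    intro e
    by_cases hs : D.src e = s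
    · rw [mu, if_pos hs, Nat.card_eq_one_iff_unique]
      refine ⟨⟨?_⟩, ⟨⟨[], Or.inl ⟨rfl, hs⟩⟩⟩⟩
      have aux : ∀ p : List (Fin q),
          ((p = [] ∧ D.src e = s) ∨ D.IsPath s (D.src e) p) → p = [] := by
        rintro p (h | h)
        · exact h.1
        · have := h.lt hlt
          rw [hs] at this
          exact absurd this (lt_irrefl _)
      rintro ⟨p, hp⟩ ⟨p', hp'⟩
      rw [Subtype.mk.injEq, aux p hp, aux p' hp']
    · rw [mu, if_neg hs, pathCount]
      refine Nat.card_congr (Equiv.subtypeEquivRight fun p => ?_)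
      simp [hs]
  let φ : (Σ e : {e // D.tgt e = v}, {p : List (Fin q) //
      (p = [] ∧ D.src e.1 = s) ∨ D.IsPath s (D.src e.1) p}) →
      {p : List (Fin q) // D.IsPath s v p} :=
    fun x => ⟨x.2.1 ++ [x.1.1], (D.isPath_append_singleton _ _ _ _).2 ⟨x.1.2, x.2.2⟩⟩
  have hφ : Function.Bijective φ := by
    constructor
    · rintro ⟨⟨e, he⟩, p, hp⟩ ⟨⟨e', he'⟩, p', hp'⟩ h
      have h' : p = p' ∧ e = e' := by
        have := congrArg Subtype.val h
        simpa using List.append_inj' (this : p ++ [e] = p' ++ [e']) rfl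
      obtain ⟨rfl, rfl⟩ := h'
      rfl
    · rintro ⟨p, hp⟩
      obtain ⟨e, r, rfl, -⟩ := hp.2.1
      have := (D.isPath_append_singleton _ _ _ _).1 hp
      exact ⟨⟨⟨e, this.1⟩, r, this.2⟩, rfl⟩
  rw [mu, if_neg hv, pathCount, ← Nat.card_congr (Equiv.ofBijective φ hφ), Nat.card_sigma]
  simp only [hcard]
  exact (Finset.sum_subtype _ (by simp) (fun e => D.mu s (D.src e))).symm

lemma threeRegular_iff (D : Multigraph m q) : D.ThreeRegular ↔
    ∀ v, ∑ e, ((if D.src e = v then 1 else 0) + (if D.tgt e = v then 1 else 0)) = 3 := by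
  refine forall_congr' fun v => ?_
  rw [Finset.sum_add_distrib, ← Finset.card_filter, ← Finset.card_filter, indeg, outdeg,
    add_comm]

lemma sum_split (l : List (Fin q)) (hl : l.Nodup) (g : Fin q → ℕ) :
    ∑ e, g e = (l.map g).sum + ∑ e with e ∉ l, g e := by
  have := Finset.sum_filter_add_sum_filter_not Finset.univ (fun e => e ∈ l) g
  rw [← this, ← List.sum_toFinset g hl]
  congr 1
  refine Finset.sum_congr (by ext; simp) fun _ _ => rfl

/-- The same multigraph with all edges reversed and the order of the vertices reversed. -/
def reverse (D : Multigraph m q) : Multigraph m q where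
  src e := (D.tgt e).rev
  tgt e := (D.src e).rev

@[simp] lemma reverse_reverse (D : Multigraph m q) : D.reverse.reverse = D := by
  simp [reverse]

lemma IsHamPathDigraph.reverse {D : Multigraph m q} {H : Fin (m - 1) → Fin q}
    (h : D.IsHamPathDigraph H) : D.reverse.IsHamPathDigraph (H ∘ Fin.rev) := by
  refine ⟨h.1.comp Fin.rev_injective, fun i => ?_, fun e => ?_⟩
  · have := h.2.1 i.rev
    have := i.2
    simp only [Multigraph.reverse, Function.comp, Fin.val_rev] at *
    omega
  · have := h.2.2 e
    simp only [Multigraph.reverse, Fin.val_rev]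
    omega

lemma indeg_reverse (D : Multigraph m q) (v : Fin m) : D.reverse.indeg v = D.outdeg v.rev := by
  simp [indeg, outdeg, Multigraph.reverse, Fin.rev_eq_iff]

lemma outdeg_reverse (D : Multigraph m q) (v : Fin m) : D.reverse.outdeg v = D.indeg v.rev := by
  simp [indeg, outdeg, Multigraph.reverse, Fin.rev_eq_iff]

lemma ThreeRegular.reverse {D : Multigraph m q} (h : D.ThreeRegular) :
    D.reverse.ThreeRegular := by
  intro v
  rw [indeg_reverse, outdeg_reverse, add_comm]
  exact h _

lemma EdgeConnected.reverse {D : Multigraph m q} (h : D.EdgeConnected 3) :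
    D.reverse.EdgeConnected 3 := by
  refine CutThree.edgeConnected h.1 fun σ ⟨x, y, hxy⟩ => ?_
  have := h.cutThree (fun v => σ v.rev) ⟨x.rev, y.rev, by simpa using hxy⟩
  simpa [cut, Multigraph.reverse, Bool.xor_comm] using this

lemma IsPath.reverse {D : Multigraph m q} {s v : Fin m} {p : List (Fin q)}
    (h : D.IsPath s v p) : D.reverse.IsPath v.rev s.rev p.reverse := by
  obtain ⟨⟨e1, r1, h1, hs⟩, ⟨e2, r2, h2, ht⟩, hc⟩ := h
  refine ⟨⟨e2, r2.reverse, by simp [h2], by simp [Multigraph.reverse, ht]⟩,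
    ⟨e1, r1.reverse, by simp [h1], by simp [Multigraph.reverse, hs]⟩, ?_⟩
  refine List.isChain_reverse.2 (List.IsChain.imp ?_ hc)
  intro a b hab
  simp [Multigraph.reverse, hab]

lemma pathCount_reverse (D : Multigraph m q) (s v : Fin m) :
    D.reverse.pathCount v.rev s.rev = D.pathCount s v := by
  refine Nat.card_congr ⟨fun p => ⟨p.1.reverse, by simpa using p.2.reverse⟩,
    fun p => ⟨p.1.reverse, p.2.reverse⟩, fun p => ?_, fun p => ?_⟩
  · simp
  · simp

lemma mu_reverse (D : Multigraph m q) (s v : Fin m) :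
    D.reverse.mu v.rev s.rev = D.mu s v := by
  simp only [mu, pathCount_reverse, Fin.rev_inj, eq_comm]

set_option synthInstance.maxSize 1000 in
set_option synthInstance.maxHeartbeats 400000 in
lemma three_le_swap (p u r s t a b j : Bool) (h : ℕ)
    (hh : (p ^^ u).toNat + (r ^^ s).toNat + (s ^^ t).toNat ≤ h)
    (H : ∀ a' b' j' : Bool, (¬(a' = p ∧ b' = p ∧ j' = p ∧ u = p ∧ r = p ∧ s = p ∧ t = p) ∨
      (a' = a ∧ b' = b ∧ j' = j)) →
      3 ≤ (p ^^ a').toNat + (a' ^^ b').toNat + (b' ^^ j').toNat + (j' ^^ r).toNat +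
        (a' ^^ s).toNat + (b' ^^ t).toNat + (u ^^ j').toNat + h) :
    3 ≤ (p ^^ a).toNat + (a ^^ b).toNat + (b ^^ j).toNat + (j ^^ r).toNat +
        (a ^^ s).toNat + (j ^^ t).toNat + (u ^^ b).toNat + h := by
  rcases (by omega : h = 0 ∨ h = 1 ∨ h = 2 ∨ 3 ≤ h) with rfl | rfl | rfl | h3
  · revert p u r s t a b j
    decide +kernel
  · revert p u r s t a b j
    decide +kernel
  · revert p u r s t a b j
    decide +kernel
  · omega

set_option synthInstance.maxSize 1000 in
set_option synthInstance.maxHeartbeats 400000 in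
lemma three_le_swap' (p u r s t a b j : Bool) (h : ℕ)
    (hh : (p ^^ u).toNat + (r ^^ s).toNat + (s ^^ t).toNat ≤ h)
    (H : ∀ a' b' j' : Bool, (¬(a' = p ∧ b' = p ∧ j' = p ∧ u = p ∧ r = p ∧ s = p ∧ t = p) ∨
      (a' = a ∧ b' = b ∧ j' = j)) →
      3 ≤ (p ^^ a').toNat + (a' ^^ b').toNat + (b' ^^ j').toNat + (j' ^^ r).toNat +
        (b' ^^ s).toNat + (a' ^^ t).toNat + (u ^^ j').toNat + h) :
    3 ≤ (p ^^ a).toNat + (a ^^ b).toNat + (b ^^ j).toNat + (j ^^ r).toNat +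
        (a ^^ s).toNat + (j ^^ t).toNat + (u ^^ b).toNat + h := by
  rcases (by omega : h = 0 ∨ h = 1 ∨ h = 2 ∨ 3 ≤ h) with rfl | rfl | rfl | h3
  · revert p u r s t a b j
    decide +kernel
  · revert p u r s t a b j
    decide +kernel
  · revert p u r s t a b j
    decide +kernel
  · omega

set_option synthInstance.maxSize 1000 in
set_option synthInstance.maxHeartbeats 400000 in
lemma three_le_triangle (c x w r a b j : Bool) (h : ℕ)
    (H : ∀ a' b' j' : Bool, (¬(a' = c ∧ b' = c ∧ j' = c ∧ x = c ∧ w = c ∧ r = c) ∨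
      (a' = a ∧ b' = b ∧ j' = j)) →
      3 ≤ (c ^^ a').toNat + (a' ^^ b').toNat + (b' ^^ j').toNat + (j' ^^ r).toNat +
        (c ^^ x).toNat + (a' ^^ j').toNat + (b' ^^ w).toNat + h) :
    3 ≤ (c ^^ a).toNat + (a ^^ b).toNat + (b ^^ j).toNat + (j ^^ r).toNat +
        (a ^^ x).toNat + (c ^^ j).toNat + (b ^^ w).toNat + h := by
  rcases (by omega : h = 0 ∨ h = 1 ∨ h = 2 ∨ 3 ≤ h) with rfl | rfl | rfl | h3
  · revert c x w r a b j
    decide +kernel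
  · revert c x w r a b j
    decide +kernel
  · revert c x w r a b j
    decide +kernel
  · omega

lemma xor_le_sum_ham {D : Multigraph m q} {H : Fin (m - 1) → Fin q} (hD : D.IsHamPathDigraph H)
    (σ : Fin m → Bool) (i l : ℕ) (hil : i ≤ l) (hl : l < m) :
    (σ ⟨i, by omega⟩ ^^ σ ⟨l, hl⟩).toNat ≤
      ∑ e with (∃ c, e = H c ∧ i ≤ c.val ∧ c.val < l),
        (σ (D.src e) ^^ σ (D.tgt e)).toNat := by
  induction l, hil using Nat.le_induction with
  | base => simp
  | succ l hil ih =>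
    have hc := hD.2.1 ⟨l, by omega⟩
    have hs : D.src (H ⟨l, by omega⟩) = ⟨l, by omega⟩ := Fin.ext hc.1
    have ht : D.tgt (H ⟨l, by omega⟩) = ⟨l + 1, hl⟩ := Fin.ext hc.2
    have hset : Finset.univ.filter (fun e => ∃ c, e = H c ∧ i ≤ c.val ∧ c.val < l + 1) =
        insert (H ⟨l, by omega⟩)
          (Finset.univ.filter (fun e => ∃ c, e = H c ∧ i ≤ c.val ∧ c.val < l)) := by
      ext e
      simp only [Finset.mem_filter, Finset.mem_univ, true_and, Finset.mem_insert]
      constructor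
      · rintro ⟨c, rfl, h1, h2⟩
        rcases Nat.lt_succ_iff_lt_or_eq.1 h2 with h | h
        · exact Or.inr ⟨c, rfl, h1, h⟩
        · left
          congr 1
          exact Fin.ext h
      · rintro (rfl | ⟨c, rfl, h1, h2⟩)
        · exact ⟨_, rfl, hil, Nat.lt_succ_self l⟩
        · exact ⟨c, rfl, h1, by omega⟩
    rw [hset, Finset.sum_insert, hs, ht]
    · refine le_trans ?_ (Nat.add_le_add_left (ih (by omega)) _)
      cases σ ⟨i, by omega⟩ <;> cases σ ⟨l, by omega⟩ <;> cases σ ⟨l + 1, hl⟩ <;> decide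
    · simp only [Finset.mem_filter, Finset.mem_univ, true_and, not_exists, not_and, not_lt]
      intro c hc' _
      rw [← hD.1 hc']

/-- Recolouring of three consecutive vertices. -/
def recolour (σ : Fin m → Bool) (k : ℕ) (a b j : Bool) : Fin m → Bool := fun v =>
  if v.val = k then a else if v.val = k + 1 then b else if v.val = k + 2 then j else σ v

lemma recolour_of_ne (σ : Fin m → Bool) (k : ℕ) (a b j : Bool) {v : Fin m}
    (hv : v.val < k ∨ k + 2 < v.val) : recolour σ k a b j v = σ v := by
  unfold recolour
  rw [if_neg (by omega), if_neg (by omega), if_neg (by omega)]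

lemma recolour_self (σ : Fin m → Bool) (k : ℕ) (hk : k + 2 < m) :
    recolour σ k (σ ⟨k, by omega⟩) (σ ⟨k + 1, by omega⟩) (σ ⟨k + 2, hk⟩) = σ := by
  ext v
  unfold recolour
  split_ifs with h1 h2 h3
  · exact congrArg σ (Fin.ext h1.symm)
  · exact congrArg σ (Fin.ext h2.symm)
  · exact congrArg σ (Fin.ext h3.symm)
  · rfl

lemma recolour_zero (σ : Fin m → Bool) (k : ℕ) (a b j : Bool) {v : Fin m} (hv : v.val = k) :
    recolour σ k a b j v = a := by
  simp [recolour, hv]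

lemma recolour_one (σ : Fin m → Bool) (k : ℕ) (a b j : Bool) {v : Fin m} (hv : v.val = k + 1) :
    recolour σ k a b j v = b := by
  simp [recolour, hv]

lemma recolour_two (σ : Fin m → Bool) (k : ℕ) (a b j : Bool) {v : Fin m} (hv : v.val = k + 2) :
    recolour σ k a b j v = j := by
  simp [recolour, hv]

/-- The ends of the edge `e` avoid the vertices `k`, `k + 1`, `k + 2`. -/
def Outside (D : Multigraph m q) (k : ℕ) (e : Fin q) : Prop :=
  ((D.src e).val < k ∨ k + 2 < (D.src e).val) ∧ ((D.tgt e).val < k ∨ k + 2 < (D.tgt e).val)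

lemma sum_recolour (D : Multigraph m q) (k : ℕ) (l : List (Fin q))
    (hl : ∀ e, e ∉ l → D.Outside k e) (σ : Fin m → Bool) (a b j : Bool) :
    ∑ e with e ∉ l, (recolour σ k a b j (D.src e) ^^ recolour σ k a b j (D.tgt e)).toNat =
      ∑ e with e ∉ l, (σ (D.src e) ^^ σ (D.tgt e)).toNat := by
  refine Finset.sum_congr rfl fun e he => ?_
  have := hl e (by simpa using he)
  rw [recolour_of_ne _ _ _ _ _ this.1, recolour_of_ne _ _ _ _ _ this.2]

/-- The four edges of the Hamiltonian path at the vertices `k`, `k + 1`, `k + 2`, together with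
three further edges. -/
def localEdges (H : Fin (m - 1) → Fin q) (k : ℕ) (hk : k + 3 < m) (e₁ e₂ e₃ : Fin q) :
    List (Fin q) :=
  [H ⟨k - 1, by omega⟩, H ⟨k, by omega⟩, H ⟨k + 1, by omega⟩, H ⟨k + 2, by omega⟩, e₁, e₂, e₃]

lemma localEdges_nodup {H : Fin (m - 1) → Fin q} (hH : Function.Injective H) {k : ℕ}
    (hk1 : 1 ≤ k) (hk : k + 3 < m) {e₁ e₂ e₃ : Fin q} (h₁ : ∀ c, e₁ ≠ H c) (h₂ : ∀ c, e₂ ≠ H c)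
    (h₃ : ∀ c, e₃ ≠ H c) (h12 : e₁ ≠ e₂) (h13 : e₁ ≠ e₃) (h23 : e₂ ≠ e₃) :
    (localEdges H k hk e₁ e₂ e₃).Nodup := by
  have h1' := fun c => (h₁ c).symm
  have h2' := fun c => (h₂ c).symm
  have h3' := fun c => (h₃ c).symm
  simp only [localEdges, List.nodup_cons, List.mem_cons, hH.eq_iff, Fin.mk.injEq, h1', h2', h3',
    h12, h13, h23, List.not_mem_nil, List.nodup_nil, or_false, not_false_eq_true, and_true,
    not_or]
  omega

lemma outside_of_notMem {D : Multigraph m q} {H : Fin (m - 1) → Fin q}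
    (hD : D.IsHamPathDigraph H) {k : ℕ} (hk : k + 3 < m) {e₁ e₂ e₃ : Fin q}
    (hinc : ∀ e, (∀ c, e ≠ H c) → e ≠ e₁ → e ≠ e₂ → e ≠ e₃ → D.Outside k e)
    (e : Fin q) (he : e ∉ localEdges H k hk e₁ e₂ e₃) : D.Outside k e := by
  simp only [localEdges, List.mem_cons, List.not_mem_nil, or_false, not_or] at he
  by_cases hc : ∃ c, e = H c
  · obtain ⟨c, rfl⟩ := hc
    have := hD.2.1 c
    simp only [hD.1.eq_iff, Fin.ext_iff] at he
    unfold Outside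
    omega
  · push Not at hc
    exact hinc e hc he.2.2.2.2.1 he.2.2.2.2.2.1 he.2.2.2.2.2.2

lemma cut_eq_sum_localEdges (D : Multigraph m q) {H : Fin (m - 1) → Fin q}
    (hD : D.IsHamPathDigraph H) {k : ℕ} (hk : k + 3 < m) {e₁ e₂ e₃ : Fin q}
    (hnd : (localEdges H k hk e₁ e₂ e₃).Nodup) (hk1 : 1 ≤ k) (τ : Fin m → Bool) :
    D.cut τ = (τ ⟨k - 1, by omega⟩ ^^ τ ⟨k, by omega⟩).toNat +
      (τ ⟨k, by omega⟩ ^^ τ ⟨k + 1, by omega⟩).toNat +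
      (τ ⟨k + 1, by omega⟩ ^^ τ ⟨k + 2, by omega⟩).toNat +
      (τ ⟨k + 2, by omega⟩ ^^ τ ⟨k + 3, by omega⟩).toNat +
      (τ (D.src e₁) ^^ τ (D.tgt e₁)).toNat + (τ (D.src e₂) ^^ τ (D.tgt e₂)).toNat +
      (τ (D.src e₃) ^^ τ (D.tgt e₃)).toNat +
      ∑ e with e ∉ localEdges H k hk e₁ e₂ e₃, (τ (D.src e) ^^ τ (D.tgt e)).toNat := by
  have hs : ∀ c, D.src (H c) = ⟨c.val, by omega⟩ := fun c => Fin.ext (hD.2.1 c).1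
  have ht : ∀ c, D.tgt (H c) = ⟨c.val + 1, by omega⟩ := fun c => Fin.ext (hD.2.1 c).2
  have hk' : k - 1 + 1 = k := by omega
  rw [cut, sum_split _ hnd]
  simp only [localEdges, List.map_cons, List.map_nil, List.sum_cons, List.sum_nil, hs, ht, hk']
  ring

/-- Exchange of the roles of an out-vertex `k + 1` and the in-vertex `k + 2`: the edge `eu`
now enters `k + 1`, and `es`, `et` leave `k` and `k + 2`. -/
def swap (D : Multigraph m q) (k : ℕ) (hk : k + 3 < m) (es et eu : Fin q) : Multigraph m q where
  src := Function.update (Function.update D.src es ⟨k, by omega⟩) et ⟨k + 2, by omega⟩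
  tgt := Function.update D.tgt eu ⟨k + 1, by omega⟩

/-- Exchange of the sources `k - 1` of `ex` and `k` of `eu`. -/
def unfoldTriangle (D : Multigraph m q) (k : ℕ) (hk : k + 3 < m) (ex eu : Fin q) :
    Multigraph m q where
  src := Function.update (Function.update D.src ex ⟨k, by omega⟩) eu ⟨k - 1, by omega⟩
  tgt := D.tgt

/-- The local situation in which `swap` applies. -/
structure SwapData (D : Multigraph m q) (H : Fin (m - 1) → Fin q) (k : ℕ)
    (es et eu : Fin q) : Prop where
  one_le : 1 ≤ k
  lt : k + 3 < m
  s_ne : ∀ c, es ≠ H c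
  t_ne : ∀ c, et ≠ H c
  u_ne : ∀ c, eu ≠ H c
  st_ne : es ≠ et
  src_st : (D.src es).val = k ∧ (D.src et).val = k + 1 ∨
    (D.src es).val = k + 1 ∧ (D.src et).val = k
  tgt_s : k + 2 < (D.tgt es).val
  tgt_le : (D.tgt es).val ≤ (D.tgt et).val
  src_u : (D.src eu).val < k
  tgt_u : (D.tgt eu).val = k + 2
  outside : ∀ e, (∀ c, e ≠ H c) → e ≠ es → e ≠ et → e ≠ eu → D.Outside k e

namespace SwapData

variable {D : Multigraph m q} {H : Fin (m - 1) → Fin q} {k : ℕ} {es et eu : Fin q}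

lemma su_ne (h : D.SwapData H k es et eu) : es ≠ eu := by
  rintro rfl
  have := h.tgt_s
  have := h.tgt_u
  omega

lemma tu_ne (h : D.SwapData H k es et eu) : et ≠ eu := by
  rintro rfl
  have := h.tgt_s
  have := h.tgt_u
  have := h.tgt_le
  omega

lemma swap_src_s (h : D.SwapData H k es et eu) :
    (D.swap k h.lt es et eu).src es = ⟨k, by have := h.lt; omega⟩ := by
  simp [swap, Function.update_of_ne h.st_ne]

lemma swap_src_t (h : D.SwapData H k es et eu) :
    (D.swap k h.lt es et eu).src et = ⟨k + 2, by have := h.lt; omega⟩ := by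
  simp [swap]

lemma swap_src (h : D.SwapData H k es et eu) {e : Fin q} (hs : e ≠ es) (ht : e ≠ et) :
    (D.swap k h.lt es et eu).src e = D.src e := by
  simp [swap, hs, ht]

lemma swap_tgt_u (h : D.SwapData H k es et eu) :
    (D.swap k h.lt es et eu).tgt eu = ⟨k + 1, by have := h.lt; omega⟩ := by
  simp [swap]

lemma swap_tgt (h : D.SwapData H k es et eu) {e : Fin q} (hu : e ≠ eu) :
    (D.swap k h.lt es et eu).tgt e = D.tgt e := by
  simp [swap, hu]

lemma isHam (h : D.SwapData H k es et eu) (hD : D.IsHamPathDigraph H) :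
    (D.swap k h.lt es et eu).IsHamPathDigraph H := by
  refine ⟨hD.1, fun c => ?_, fun e => ?_⟩
  · rw [h.swap_src (h.s_ne c).symm (h.t_ne c).symm, h.swap_tgt (h.u_ne c).symm]
    exact hD.2.1 c
  · have h1 := h.tgt_s
    have h2 := h.tgt_le
    have h3 := h.src_u
    by_cases hs : e = es
    · subst hs
      rw [h.swap_src_s, h.swap_tgt h.su_ne]
      simp only
      omega
    by_cases ht : e = et
    · subst ht
      rw [h.swap_src_t, h.swap_tgt h.tu_ne]
      simp only
      omega
    rw [h.swap_src hs ht]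
    by_cases hu : e = eu
    · subst hu
      rw [h.swap_tgt_u]
      simp only
      omega
    · rw [h.swap_tgt hu]
      exact hD.2.2 e

lemma threeRegular (h : D.SwapData H k es et eu) (hD : D.ThreeRegular) :
    (D.swap k h.lt es et eu).ThreeRegular := by
  rw [threeRegular_iff] at hD ⊢
  intro v
  have hv := hD v
  have hnd : [es, et, eu].Nodup := by simp [h.st_ne, h.su_ne, h.tu_ne]
  rw [sum_split _ hnd] at hv ⊢
  have hrest : ∑ e with e ∉ [es, et, eu], ((if (D.swap k h.lt es et eu).src e = v then 1 else 0) +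
      (if (D.swap k h.lt es et eu).tgt e = v then 1 else 0)) =
      ∑ e with e ∉ [es, et, eu], ((if D.src e = v then 1 else 0) +
      (if D.tgt e = v then 1 else 0)) := by
    refine Finset.sum_congr rfl fun e he => ?_
    simp only [List.mem_cons, List.not_mem_nil, or_false, not_or, Finset.mem_filter,
      Finset.mem_univ, true_and] at he
    rw [h.swap_src he.1 he.2.1, h.swap_tgt he.2.2]
  rw [hrest]
  simp only [List.map_cons, List.map_nil, List.sum_cons, List.sum_nil, h.swap_src_s,
    h.swap_src_t, h.swap_src h.su_ne.symm h.tu_ne.symm, h.swap_tgt_u, h.swap_tgt h.su_ne,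
    h.swap_tgt h.tu_ne] at hv ⊢
  refine Eq.trans ?_ hv
  have hlt := h.lt
  have h1 : D.tgt eu = ⟨k + 2, by omega⟩ := Fin.ext h.tgt_u
  rw [h1]
  rcases h.src_st with ⟨h2, h3⟩ | ⟨h2, h3⟩
  · have h2 : D.src es = ⟨k, by omega⟩ := Fin.ext h2
    have h3 : D.src et = ⟨k + 1, by omega⟩ := Fin.ext h3
    rw [h2, h3]
    ring
  · have h2 : D.src es = ⟨k + 1, by omega⟩ := Fin.ext h2
    have h3 : D.src et = ⟨k, by omega⟩ := Fin.ext h3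
    rw [h2, h3]
    ring

lemma nodup (h : D.SwapData H k es et eu) (hD : D.IsHamPathDigraph H) :
    (localEdges H k h.lt es et eu).Nodup :=
  localEdges_nodup hD.1 h.one_le h.lt h.s_ne h.t_ne h.u_ne h.st_ne h.su_ne h.tu_ne

lemma le_sum_rest (h : D.SwapData H k es et eu) (hD : D.IsHamPathDigraph H)
    (σ : Fin m → Bool) :
    (σ ⟨k - 1, by have := h.lt; omega⟩ ^^ σ (D.src eu)).toNat +
      (σ ⟨k + 3, h.lt⟩ ^^ σ (D.tgt es)).toNat + (σ (D.tgt es) ^^ σ (D.tgt et)).toNat ≤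
      ∑ e with e ∉ localEdges H k h.lt es et eu, (σ (D.src e) ^^ σ (D.tgt e)).toNat := by
  have hk := h.one_le
  have hlt := h.lt
  have h1 := xor_le_sum_ham hD σ (D.src eu).val (k - 1) (by have := h.src_u; omega) (by omega)
  have h2 := xor_le_sum_ham hD σ (k + 3) (D.tgt es).val (by have := h.tgt_s; omega)
    (D.tgt es).2
  have h3 := xor_le_sum_ham hD σ (D.tgt es).val (D.tgt et).val h.tgt_le (D.tgt et).2
  have hts := h.tgt_s
  have hle := h.tgt_le
  rw [Bool.xor_comm] at h1
  refine (Nat.add_le_add (Nat.add_le_add h1 h2) h3).trans ?_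
  rw [← Finset.sum_union, ← Finset.sum_union]
  · refine Finset.sum_le_sum_of_subset fun e he => ?_
    simp only [Finset.mem_union, Finset.mem_filter, Finset.mem_univ, true_and] at he
    have : ∃ c, e = H c ∧ (c.val < k - 1 ∨ k + 2 < c.val) := by
      rcases he with (⟨c, rfl, hc⟩ | ⟨c, rfl, hc⟩) | ⟨c, rfl, hc⟩
      · exact ⟨c, rfl, by omega⟩
      · exact ⟨c, rfl, by omega⟩
      · exact ⟨c, rfl, by omega⟩
    clear he
    obtain ⟨c, rfl, hc⟩ := this
    simp only [Finset.mem_filter, Finset.mem_univ, true_and, localEdges, List.mem_cons,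
      hD.1.eq_iff, (h.s_ne c).symm, (h.t_ne c).symm, (h.u_ne c).symm, List.not_mem_nil,
      or_false, not_or, not_false_eq_true, and_true]
    rw [Fin.ext_iff, Fin.ext_iff, Fin.ext_iff, Fin.ext_iff]
    simp only
    omega
  · rw [Finset.disjoint_left]
    intro e he he'
    simp only [Finset.mem_union, Finset.mem_filter, Finset.mem_univ, true_and] at he he'
    obtain ⟨c, rfl, hc⟩ := he'
    rcases he with ⟨c', hc', h'⟩ | ⟨c', hc', h'⟩
    · have := hD.1 hc'
      subst this
      omega
    · have := hD.1 hc'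
      subst this
      omega
  · rw [Finset.disjoint_left]
    intro e he he'
    simp only [Finset.mem_filter, Finset.mem_univ, true_and] at he he'
    obtain ⟨c, rfl, hc⟩ := he'
    obtain ⟨c', hc', h'⟩ := he
    have := hD.1 hc'
    subst this
    omega

lemma cutThree (h : D.SwapData H k es et eu) (hD : D.IsHamPathDigraph H) (hc : D.CutThree) :
    (D.swap k h.lt es et eu).CutThree := by
  intro σ hσ
  have hlt := h.lt
  have hk := h.one_le
  have hnd := h.nodup hD
  have hrest : ∑ e with e ∉ localEdges H k h.lt es et eu,
      (σ ((D.swap k h.lt es et eu).src e) ^^ σ ((D.swap k h.lt es et eu).tgt e)).toNat =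
      ∑ e with e ∉ localEdges H k h.lt es et eu, (σ (D.src e) ^^ σ (D.tgt e)).toNat := by
    refine Finset.sum_congr rfl fun e he => ?_
    simp only [localEdges, List.mem_cons, List.not_mem_nil, or_false, not_or, Finset.mem_filter,
      Finset.mem_univ, true_and] at he
    rw [h.swap_src he.2.2.2.2.1 he.2.2.2.2.2.1, h.swap_tgt he.2.2.2.2.2.2]
  rw [cut_eq_sum_localEdges _ (h.isHam hD) h.lt hnd hk, hrest, h.swap_src_s, h.swap_src_t,
    h.swap_src h.su_ne.symm h.tu_ne.symm, h.swap_tgt_u, h.swap_tgt h.su_ne, h.swap_tgt h.tu_ne]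
  have hle := h.le_sum_rest hD σ
  have hts := h.tgt_s
  have htle := h.tgt_le
  have key : ∀ a' b' j' : Bool,
      (¬(a' = σ ⟨k - 1, by omega⟩ ∧ b' = σ ⟨k - 1, by omega⟩ ∧ j' = σ ⟨k - 1, by omega⟩ ∧
        σ (D.src eu) = σ ⟨k - 1, by omega⟩ ∧ σ ⟨k + 3, hlt⟩ = σ ⟨k - 1, by omega⟩ ∧
        σ (D.tgt es) = σ ⟨k - 1, by omega⟩ ∧ σ (D.tgt et) = σ ⟨k - 1, by omega⟩) ∨
      (a' = σ ⟨k, by omega⟩ ∧ b' = σ ⟨k + 1, by omega⟩ ∧ j' = σ ⟨k + 2, by omega⟩)) →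
      3 ≤ D.cut (recolour σ k a' b' j') := by
    rintro a' b' j' (hne | ⟨rfl, rfl, rfl⟩)
    · apply hc
      by_contra! hall
      refine hne ?_
      have hp : recolour σ k a' b' j' ⟨k - 1, by omega⟩ = σ ⟨k - 1, by omega⟩ :=
        recolour_of_ne _ _ _ _ _ (Or.inl (by simp only; omega))
      refine ⟨?_, ?_, ?_, ?_, ?_, ?_, ?_⟩
      · rw [← hp, ← hall ⟨k, by omega⟩, recolour_zero _ _ _ _ _ (v := ⟨k, _⟩) rfl]
      · rw [← hp, ← hall ⟨k + 1, by omega⟩, recolour_one _ _ _ _ _ (v := ⟨k + 1, _⟩) rfl]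
      · rw [← hp, ← hall ⟨k + 2, by omega⟩, recolour_two _ _ _ _ _ (v := ⟨k + 2, _⟩) rfl]
      · rw [← hp, ← hall (D.src eu), recolour_of_ne _ _ _ _ _ (Or.inl h.src_u)]
      · rw [← hp, ← hall ⟨k + 3, hlt⟩,
          recolour_of_ne _ _ _ _ _ (Or.inr (by simp only; omega))]
      · rw [← hp, ← hall (D.tgt es), recolour_of_ne _ _ _ _ _ (Or.inr h.tgt_s)]
      · rw [← hp, ← hall (D.tgt et), recolour_of_ne _ _ _ _ _ (Or.inr (by omega))]
    · rw [recolour_self _ _ (by omega)]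
      exact hc σ hσ
  have key2 : ∀ a' b' j' : Bool, D.cut (recolour σ k a' b' j') =
      (σ ⟨k - 1, by omega⟩ ^^ a').toNat + (a' ^^ b').toNat + (b' ^^ j').toNat +
      (j' ^^ σ ⟨k + 3, hlt⟩).toNat +
      (recolour σ k a' b' j' (D.src es) ^^ σ (D.tgt es)).toNat +
      (recolour σ k a' b' j' (D.src et) ^^ σ (D.tgt et)).toNat + (σ (D.src eu) ^^ j').toNat +
      ∑ e with e ∉ localEdges H k h.lt es et eu, (σ (D.src e) ^^ σ (D.tgt e)).toNat := by
    intro a' b' j'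
    rw [cut_eq_sum_localEdges _ hD h.lt hnd hk,
      sum_recolour D k _ (outside_of_notMem hD h.lt h.outside),
      recolour_of_ne σ k a' b' j' (v := ⟨k - 1, _⟩) (Or.inl (by simp only; omega)),
      recolour_of_ne σ k a' b' j' (v := ⟨k + 3, _⟩) (Or.inr (by simp only; omega)),
      recolour_zero σ k a' b' j' (v := ⟨k, _⟩) rfl,
      recolour_one σ k a' b' j' (v := ⟨k + 1, _⟩) rfl,
      recolour_two σ k a' b' j' (v := ⟨k + 2, _⟩) rfl,
      recolour_of_ne σ k a' b' j' (v := D.src eu) (Or.inl h.src_u),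
      recolour_two σ k a' b' j' (v := D.tgt eu) h.tgt_u,
      recolour_of_ne σ k a' b' j' (v := D.tgt es) (Or.inr h.tgt_s),
      recolour_of_ne σ k a' b' j' (v := D.tgt et) (Or.inr (by omega))]
  rcases h.src_st with ⟨h1, h2⟩ | ⟨h1, h2⟩
  · refine three_le_swap _ _ _ _ _ _ _ _ _ hle fun a' b' j' hor => ?_
    have := key a' b' j' hor
    rwa [key2, recolour_zero _ _ _ _ _ h1, recolour_one _ _ _ _ _ h2] at this
  · refine three_le_swap' _ _ _ _ _ _ _ _ _ hle fun a' b' j' hor => ?_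
    have := key a' b' j' hor
    rwa [key2, recolour_one _ _ _ _ _ h1, recolour_zero _ _ _ _ _ h2] at this

end SwapData

/-- The local situation in which `unfoldTriangle` applies. -/
structure TriangleData (D : Multigraph m q) (H : Fin (m - 1) → Fin q) (k : ℕ)
    (ex eu ew : Fin q) : Prop where
  one_le : 1 ≤ k
  lt : k + 3 < m
  x_ne : ∀ c, ex ≠ H c
  u_ne : ∀ c, eu ≠ H c
  w_ne : ∀ c, ew ≠ H c
  src_x : (D.src ex).val = k - 1
  src_u : (D.src eu).val = k
  src_w : (D.src ew).val = k + 1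
  tgt_x : k + 2 < (D.tgt ex).val
  tgt_u : (D.tgt eu).val = k + 2
  tgt_w : k + 2 < (D.tgt ew).val
  outside : ∀ e, (∀ c, e ≠ H c) → e ≠ ex → e ≠ eu → e ≠ ew → D.Outside k e

namespace TriangleData

variable {D : Multigraph m q} {H : Fin (m - 1) → Fin q} {k : ℕ} {ex eu ew : Fin q}

lemma xu_ne (h : D.TriangleData H k ex eu ew) : ex ≠ eu := by
  rintro rfl
  have := h.tgt_x
  have := h.tgt_u
  omega

lemma xw_ne (h : D.TriangleData H k ex eu ew) : ex ≠ ew := by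
  rintro rfl
  have := h.src_x
  have := h.src_w
  omega

lemma uw_ne (h : D.TriangleData H k ex eu ew) : eu ≠ ew := by
  rintro rfl
  have := h.src_u
  have := h.src_w
  omega

lemma src_x' (h : D.TriangleData H k ex eu ew) :
    (D.unfoldTriangle k h.lt ex eu).src ex = ⟨k, by have := h.lt; omega⟩ := by
  simp [unfoldTriangle, h.xu_ne]

lemma src_u' (h : D.TriangleData H k ex eu ew) :
    (D.unfoldTriangle k h.lt ex eu).src eu = ⟨k - 1, by have := h.lt; omega⟩ := by
  simp [unfoldTriangle]

lemma src' (h : D.TriangleData H k ex eu ew) {e : Fin q} (hx : e ≠ ex) (hu : e ≠ eu) :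
    (D.unfoldTriangle k h.lt ex eu).src e = D.src e := by
  simp [unfoldTriangle, hx, hu]

lemma tgt' (h : D.TriangleData H k ex eu ew) (e : Fin q) :
    (D.unfoldTriangle k h.lt ex eu).tgt e = D.tgt e := by
  simp [unfoldTriangle]

lemma isHam (h : D.TriangleData H k ex eu ew) (hD : D.IsHamPathDigraph H) :
    (D.unfoldTriangle k h.lt ex eu).IsHamPathDigraph H := by
  refine ⟨hD.1, fun c => ?_, fun e => ?_⟩
  · rw [h.src' (h.x_ne c).symm (h.u_ne c).symm, h.tgt']
    exact hD.2.1 c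
  · rw [h.tgt']
    have h1 := h.tgt_x
    have h2 := h.tgt_u
    by_cases hx : e = ex
    · subst hx
      rw [h.src_x']
      simp only
      omega
    by_cases hu : e = eu
    · subst hu
      rw [h.src_u']
      simp only
      omega
    rw [h.src' hx hu]
    exact hD.2.2 e

lemma threeRegular (h : D.TriangleData H k ex eu ew) (hD : D.ThreeRegular) :
    (D.unfoldTriangle k h.lt ex eu).ThreeRegular := by
  rw [threeRegular_iff] at hD ⊢
  intro v
  have hv := hD v
  have hnd : [ex, eu].Nodup := by simp [h.xu_ne]
  rw [sum_split _ hnd] at hv ⊢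
  have hrest : ∑ e with e ∉ [ex, eu],
      ((if (D.unfoldTriangle k h.lt ex eu).src e = v then 1 else 0) +
      (if (D.unfoldTriangle k h.lt ex eu).tgt e = v then 1 else 0)) =
      ∑ e with e ∉ [ex, eu], ((if D.src e = v then 1 else 0) +
      (if D.tgt e = v then 1 else 0)) := by
    refine Finset.sum_congr rfl fun e he => ?_
    simp only [List.mem_cons, List.not_mem_nil, or_false, not_or, Finset.mem_filter,
      Finset.mem_univ, true_and] at he
    rw [h.src' he.1 he.2, h.tgt']
  rw [hrest]
  have hlt := h.lt
  have h1 : D.src ex = ⟨k - 1, by omega⟩ := Fin.ext h.src_x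
  have h2 : D.src eu = ⟨k, by omega⟩ := Fin.ext h.src_u
  simp only [List.map_cons, List.map_nil, List.sum_cons, List.sum_nil, h.src_x', h.src_u',
    h.tgt', h1, h2] at hv ⊢
  refine Eq.trans ?_ hv
  ring

lemma nodup (h : D.TriangleData H k ex eu ew) (hD : D.IsHamPathDigraph H) :
    (localEdges H k h.lt ex eu ew).Nodup :=
  localEdges_nodup hD.1 h.one_le h.lt h.x_ne h.u_ne h.w_ne h.xu_ne h.xw_ne h.uw_ne

lemma cutThree (h : D.TriangleData H k ex eu ew) (hD : D.IsHamPathDigraph H)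
    (hc : D.CutThree) : (D.unfoldTriangle k h.lt ex eu).CutThree := by
  intro σ hσ
  have hlt := h.lt
  have hk := h.one_le
  have hnd := h.nodup hD
  have hrest : ∑ e with e ∉ localEdges H k h.lt ex eu ew,
      (σ ((D.unfoldTriangle k h.lt ex eu).src e) ^^
        σ ((D.unfoldTriangle k h.lt ex eu).tgt e)).toNat =
      ∑ e with e ∉ localEdges H k h.lt ex eu ew, (σ (D.src e) ^^ σ (D.tgt e)).toNat := by
    refine Finset.sum_congr rfl fun e he => ?_
    simp only [localEdges, List.mem_cons, List.not_mem_nil, or_false, not_or, Finset.mem_filter,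
      Finset.mem_univ, true_and] at he
    rw [h.src' he.2.2.2.2.1 he.2.2.2.2.2.1, h.tgt']
  have h1 : D.src ex = ⟨k - 1, by omega⟩ := Fin.ext h.src_x
  have h2 : D.src eu = ⟨k, by omega⟩ := Fin.ext h.src_u
  have h3 : D.src ew = ⟨k + 1, by omega⟩ := Fin.ext h.src_w
  have h4 : D.tgt eu = ⟨k + 2, by omega⟩ := Fin.ext h.tgt_u
  rw [cut_eq_sum_localEdges _ (h.isHam hD) h.lt hnd hk, hrest, h.src_x', h.src_u',
    h.src' h.xw_ne.symm h.uw_ne.symm, h.tgt', h.tgt', h.tgt', h3, h4]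
  refine three_le_triangle _ _ _ _ _ _ _ _ fun a' b' j' hor => ?_
  have key : 3 ≤ D.cut (recolour σ k a' b' j') := by
    rcases hor with hne | ⟨rfl, rfl, rfl⟩
    · apply hc
      by_contra! hall
      refine hne ?_
      have hp : recolour σ k a' b' j' ⟨k - 1, by omega⟩ = σ ⟨k - 1, by omega⟩ :=
        recolour_of_ne _ _ _ _ _ (Or.inl (by simp only; omega))
      refine ⟨?_, ?_, ?_, ?_, ?_, ?_⟩
      · rw [← hp, ← hall ⟨k, by omega⟩, recolour_zero _ _ _ _ _ (v := ⟨k, _⟩) rfl]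
      · rw [← hp, ← hall ⟨k + 1, by omega⟩, recolour_one _ _ _ _ _ (v := ⟨k + 1, _⟩) rfl]
      · rw [← hp, ← hall ⟨k + 2, by omega⟩, recolour_two _ _ _ _ _ (v := ⟨k + 2, _⟩) rfl]
      · rw [← hp, ← hall (D.tgt ex), recolour_of_ne _ _ _ _ _ (Or.inr h.tgt_x)]
      · rw [← hp, ← hall (D.tgt ew), recolour_of_ne _ _ _ _ _ (Or.inr h.tgt_w)]
      · rw [← hp, ← hall ⟨k + 3, hlt⟩,
          recolour_of_ne _ _ _ _ _ (Or.inr (by simp only; omega))]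
    · rw [recolour_self _ _ (by omega)]
      exact hc σ hσ
  rwa [cut_eq_sum_localEdges _ hD h.lt hnd hk,
    sum_recolour D k _ (outside_of_notMem hD h.lt h.outside), h1, h2, h3, h4,
    recolour_of_ne σ k a' b' j' (v := ⟨k - 1, _⟩) (Or.inl (by simp only; omega)),
    recolour_of_ne σ k a' b' j' (v := ⟨k + 3, _⟩) (Or.inr (by simp only; omega)),
    recolour_zero σ k a' b' j' (v := ⟨k, _⟩) rfl,
    recolour_one σ k a' b' j' (v := ⟨k + 1, _⟩) rfl,
    recolour_two σ k a' b' j' (v := ⟨k + 2, _⟩) rfl,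
    recolour_of_ne σ k a' b' j' (v := D.tgt ex) (Or.inr h.tgt_x),
    recolour_of_ne σ k a' b' j' (v := D.tgt ew) (Or.inr h.tgt_w)] at key

lemma isCount (h : D.TriangleData H k ex eu ew) {s : Fin m} {f : Fin m → ℕ}
    (hf : D.IsCount s f)
    (hfe : f ⟨k, by have := h.lt; omega⟩ = f ⟨k - 1, by have := h.lt; omega⟩) :
    (D.unfoldTriangle k h.lt ex eu).IsCount s f := by
  refine ⟨hf.1, fun v hv => ?_⟩
  rw [hf.2 v hv]
  have hlt := h.lt
  have h1 : D.src ex = ⟨k - 1, by omega⟩ := Fin.ext h.src_x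
  have h2 : D.src eu = ⟨k, by omega⟩ := Fin.ext h.src_u
  refine Finset.sum_congr rfl fun e _ => ?_
  by_cases hx : e = ex
  · subst hx
    rw [h.src_x', h1, hfe]
  by_cases hu : e = eu
  · subst hu
    rw [h.src_u', h2, hfe]
  rw [h.src' hx hu]

lemma outside' (h : D.TriangleData H k ex eu ew) {e : Fin q} (hc : ∀ c, e ≠ H c) (hx : e ≠ ex)
    (hu : e ≠ eu) (hw : e ≠ ew) : (D.unfoldTriangle k h.lt ex eu).Outside k e := by
  have := h.outside e hc hx hu hw
  unfold Outside at *
  rwa [h.src' hx hu]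

lemma exists_swapData (h : D.TriangleData H k ex eu ew) :
    ∃ es et, (D.unfoldTriangle k h.lt ex eu).SwapData H k es et eu := by
  have hx := congrArg Fin.val h.src_x'
  have hu := congrArg Fin.val h.src_u'
  have hw : ((D.unfoldTriangle k h.lt ex eu).src ew).val = k + 1 := by
    rw [h.src' h.xw_ne.symm h.uw_ne.symm, h.src_w]
  have hk := h.one_le
  simp only at hx hu
  rcases le_total (D.tgt ex).val (D.tgt ew).val with hle | hle
  · exact ⟨ex, ew, h.one_le, h.lt, h.x_ne, h.w_ne, h.u_ne, h.xw_ne, Or.inl ⟨hx, hw⟩, h.tgt_x,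
      hle, by omega, h.tgt_u, fun e hc h1 h2 h3 => h.outside' hc h1 h3 h2⟩
  · exact ⟨ew, ex, h.one_le, h.lt, h.w_ne, h.x_ne, h.u_ne, h.xw_ne.symm, Or.inr ⟨hw, hx⟩,
      h.tgt_w, hle, by omega, h.tgt_u, fun e hc h1 h2 h3 => h.outside' hc h2 h3 h1⟩

end TriangleData

lemma IsCount.pos {D : Multigraph m q} {H : Fin (m - 1) → Fin q} (hD : D.IsHamPathDigraph H)
    {f : Fin m → ℕ} (hm : 0 < m) (hf : D.IsCount ⟨0, hm⟩ f) (v : ℕ) (hv : v < m) :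
    0 < f ⟨v, hv⟩ := by
  induction v with
  | zero => rw [hf.1]; exact Nat.one_pos
  | succ v ih =>
    rw [hf.2 _ (by simp)]
    have hc := hD.2.1 ⟨v, by omega⟩
    have hs : D.src (H ⟨v, by omega⟩) = ⟨v, by omega⟩ := Fin.ext hc.1
    refine lt_of_lt_of_le (ih (by omega)) ?_
    rw [← hs]
    exact Finset.single_le_sum (f := fun e => f (D.src e)) (fun _ _ => Nat.zero_le _)
      (Finset.mem_filter.2 ⟨Finset.mem_univ _, Fin.ext hc.2⟩)

lemma IsCount.eq_pred {D : Multigraph m q} {H : Fin (m - 1) → Fin q}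
    (hD : D.IsHamPathDigraph H) {f : Fin m → ℕ} (hm : 0 < m) (hf : D.IsCount ⟨0, hm⟩ f)
    (v : ℕ) (hv : v + 1 < m)
    (huniq : ∀ e, (D.tgt e).val = v + 1 → e = H ⟨v, by omega⟩) :
    f ⟨v + 1, hv⟩ = f ⟨v, by omega⟩ := by
  have hc := hD.2.1 ⟨v, by omega⟩
  have hs : D.src (H ⟨v, by omega⟩) = ⟨v, by omega⟩ := Fin.ext hc.1
  have hset : Finset.univ.filter (fun e => D.tgt e = ⟨v + 1, hv⟩) = {H ⟨v, by omega⟩} := by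
    ext e
    simp only [Finset.mem_filter, Finset.mem_univ, true_and, Finset.mem_singleton]
    refine ⟨fun h => huniq e (by rw [h]), ?_⟩
    rintro rfl
    exact Fin.ext hc.2
  rw [hf.2 _ (by simp), hset, Finset.sum_singleton, hs]

lemma IsCount.eq_pred_add {D : Multigraph m q} {H : Fin (m - 1) → Fin q}
    (hD : D.IsHamPathDigraph H) {f : Fin m → ℕ} (hm : 0 < m) (hf : D.IsCount ⟨0, hm⟩ f)
    (v : ℕ) (hv : v + 1 < m) (eu : Fin q) (hu : ∀ c, eu ≠ H c) (htu : (D.tgt eu).val = v + 1)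
    (huniq : ∀ e, (D.tgt e).val = v + 1 → e = H ⟨v, by omega⟩ ∨ e = eu) :
    f ⟨v + 1, hv⟩ = f ⟨v, by omega⟩ + f (D.src eu) := by
  have hc := hD.2.1 ⟨v, by omega⟩
  have hs : D.src (H ⟨v, by omega⟩) = ⟨v, by omega⟩ := Fin.ext hc.1
  have hset : Finset.univ.filter (fun e => D.tgt e = ⟨v + 1, hv⟩) =
      {H ⟨v, by omega⟩, eu} := by
    ext e
    simp only [Finset.mem_filter, Finset.mem_univ, true_and, Finset.mem_singleton,
      Finset.mem_insert]
    refine ⟨fun h => huniq e (by rw [h]), ?_⟩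
    rintro (rfl | rfl)
    · exact Fin.ext hc.2
    · exact Fin.ext htu
  rw [hf.2 _ (by simp), hset, Finset.sum_pair (hu _).symm, hs]

namespace SwapData

variable {D : Multigraph m q} {H : Fin (m - 1) → Fin q} {k : ℕ} {es et eu : Fin q}

lemma eq_ham (h : D.SwapData H k es et eu) (hD : D.IsHamPathDigraph H) {v : ℕ}
    (hv : v + 1 < m) (hkv : k ≤ v + 1) (hvk : v ≤ k + 1) {e : Fin q} (heu : e ≠ eu)
    (he : (D.tgt e).val = v + 1) : e = H ⟨v, by omega⟩ := by
  by_contra hne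
  by_cases hc : ∃ c, e = H c
  · obtain ⟨c, rfl⟩ := hc
    apply hne
    congr 1
    have := hD.2.1 c
    exact Fin.ext (by simp only; omega)
  · push Not at hc
    have h1 := h.tgt_s
    have h2 := h.tgt_le
    have := h.outside e hc (by rintro rfl; omega) (by rintro rfl; omega) heu
    unfold Outside at this
    omega

lemma lt_count (h : D.SwapData H k es et eu) (hD : D.IsHamPathDigraph H) {f g : Fin m → ℕ}
    (hm : 0 < m) (hf : D.IsCount ⟨0, hm⟩ f)
    (hg : (D.swap k h.lt es et eu).IsCount ⟨0, hm⟩ g) :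
    f ⟨m - 1, by omega⟩ < g ⟨m - 1, by omega⟩ := by
  have hlt := h.lt
  have hk := h.one_le
  have hts := h.tgt_s
  have htle := h.tgt_le
  have hsu := h.src_u
  have htu := h.tgt_u
  have hD' := h.isHam hD
  have hlow : ∀ v : ℕ, ∀ hv : v < m, v ≤ k → g ⟨v, hv⟩ = f ⟨v, hv⟩ := by
    intro v
    induction v using Nat.strong_induction_on with
    | _ v ih =>
      intro hv hvk
      by_cases h0 : v = 0
      · subst h0
        rw [hf.1, hg.1]
      rw [hf.2 _ (by simpa using h0), hg.2 _ (by simpa using h0)]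
      refine Finset.sum_congr ?_ ?_
      · ext e
        simp only [Finset.mem_filter, Finset.mem_univ, true_and]
        by_cases he : e = eu
        · subst he
          rw [h.swap_tgt_u, Fin.ext_iff, Fin.ext_iff]
          simp only
          omega
        · rw [h.swap_tgt he]
      · intro e he
        simp only [Finset.mem_filter, Finset.mem_univ, true_and] at he
        have he' : (D.tgt e).val = v := by rw [he]
        have := hD.2.2 e
        rw [h.swap_src (by rintro rfl; omega) (by rintro rfl; omega)]
        exact ih (D.src e).val (by omega) (D.src e).2 (by omega)
  have hfb : f ⟨k + 1, by omega⟩ = f ⟨k, by omega⟩ :=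
    hf.eq_pred hD hm k (by omega) fun e he =>
      h.eq_ham hD (by omega) (by omega) (by omega) (by rintro rfl; omega) he
  have hfj : f ⟨k + 2, by omega⟩ = f ⟨k + 1, by omega⟩ + f (D.src eu) :=
    hf.eq_pred_add hD hm (k + 1) (by omega) eu h.u_ne h.tgt_u fun e he => by
      by_cases heu : e = eu
      · exact Or.inr heu
      · exact Or.inl (h.eq_ham hD (by omega) (by omega) (by omega) heu he)
  have hgb : g ⟨k + 1, by omega⟩ = g ⟨k, by omega⟩ + g (D.src eu) := by
    have := hg.eq_pred_add hD' hm k (by omega) eu h.u_ne (by rw [h.swap_tgt_u]) fun e he => by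
      by_cases heu : e = eu
      · exact Or.inr heu
      · rw [h.swap_tgt heu] at he
        exact Or.inl (h.eq_ham hD (by omega) (by omega) (by omega) heu he)
    rwa [h.swap_src h.su_ne.symm h.tu_ne.symm] at this
  have hgj : g ⟨k + 2, by omega⟩ = g ⟨k + 1, by omega⟩ :=
    hg.eq_pred hD' hm (k + 1) (by omega) fun e he => by
      by_cases heu : e = eu
      · subst heu
        rw [h.swap_tgt_u] at he
        simp only at he
        omega
      · rw [h.swap_tgt heu] at he
        exact h.eq_ham hD (by omega) (by omega) (by omega) heu he
  have hga : g ⟨k, by omega⟩ = f ⟨k, by omega⟩ := hlow k _ le_rfl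
  have hgu : g (D.src eu) = f (D.src eu) := hlow _ (D.src eu).2 hsu.le
  have hupos : 0 < f (D.src eu) := hf.pos hD hm _ _
  have hst : f (D.src es) = f ⟨k, by omega⟩ ∧ f (D.src et) = f ⟨k, by omega⟩ := by
    rcases h.src_st with ⟨h1, h2⟩ | ⟨h1, h2⟩
    · have h1 : D.src es = ⟨k, by omega⟩ := Fin.ext h1
      have h2 : D.src et = ⟨k + 1, by omega⟩ := Fin.ext h2
      rw [h1, h2, hfb]
      exact ⟨rfl, rfl⟩
    · have h1 : D.src es = ⟨k + 1, by omega⟩ := Fin.ext h1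
      have h2 : D.src et = ⟨k, by omega⟩ := Fin.ext h2
      rw [h1, h2, hfb]
      exact ⟨rfl, rfl⟩
  have hall : ∀ v : ℕ, ∀ hv : v < m, f ⟨v, hv⟩ ≤ g ⟨v, hv⟩ ∧
      ((D.tgt et).val ≤ v → f ⟨v, hv⟩ < g ⟨v, hv⟩) := by
    intro v
    induction v using Nat.strong_induction_on with
    | _ v ih =>
      intro hv
      rcases (by omega : v ≤ k ∨ v = k + 1 ∨ v = k + 2 ∨ k + 2 < v) with h1 | rfl | rfl | h1
      · exact ⟨(hlow v hv h1).ge, fun _ => by omega⟩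
      · exact ⟨by omega, fun _ => by omega⟩
      · exact ⟨by omega, fun _ => by omega⟩
      have hset : Finset.univ.filter
          (fun e => (D.swap k h.lt es et eu).tgt e = ⟨v, hv⟩) =
          Finset.univ.filter (fun e => D.tgt e = ⟨v, hv⟩) := by
        ext e
        simp only [Finset.mem_filter, Finset.mem_univ, true_and]
        by_cases he : e = eu
        · subst he
          rw [h.swap_tgt_u, Fin.ext_iff, Fin.ext_iff]
          simp only
          omega
        · rw [h.swap_tgt he]
      have hterm : ∀ e ∈ Finset.univ.filter (fun e => D.tgt e = ⟨v, hv⟩),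
          f (D.src e) ≤ g ((D.swap k h.lt es et eu).src e) := by
        intro e he
        by_cases hes : e = es
        · subst hes
          rw [h.swap_src_s, hst.1, hga]
        by_cases het : e = et
        · subst het
          rw [h.swap_src_t, hst.2]
          omega
        rw [h.swap_src hes het]
        have he' : (D.tgt e).val = v := by rw [(Finset.mem_filter.1 he).2]
        have := hD.2.2 e
        exact (ih (D.src e).val (by omega) (D.src e).2).1
      have hv0 : (⟨v, hv⟩ : Fin m) ≠ ⟨0, hm⟩ := by
        simp only [ne_eq, Fin.mk.injEq]
        omega
      rw [hf.2 _ hv0, hg.2 _ hv0, hset]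
      refine ⟨Finset.sum_le_sum hterm, fun hle => Finset.sum_lt_sum hterm ?_⟩
      rcases hle.eq_or_lt with heq | hlt'
      · refine ⟨et, by simpa [Fin.ext_iff] using heq, ?_⟩
        rw [h.swap_src_t, hst.2]
        omega
      · have hc := hD.2.1 ⟨v - 1, by omega⟩
        have hs : D.src (H ⟨v - 1, by omega⟩) = ⟨v - 1, by omega⟩ := Fin.ext hc.1
        refine ⟨H ⟨v - 1, by omega⟩, ?_, ?_⟩
        · simp only [Finset.mem_filter, Finset.mem_univ, true_and]
          exact Fin.ext (by rw [hc.2]; simp only; omega)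
        · rw [h.swap_src (h.s_ne _).symm (h.t_ne _).symm, hs]
          exact (ih _ (by omega) _).2 (by omega)
  exact (hall (m - 1) (by omega)).2 (by have := (D.tgt et).2; omega)

end SwapData

lemma exists_extra_out {D : Multigraph m q} (H : Fin (m - 1) → Fin q)
    (hD : D.IsHamPathDigraph H) {v : ℕ} (hv : v < m) (hout : 2 ≤ D.outdeg ⟨v, hv⟩) :
    ∃ e, (∀ c, e ≠ H c) ∧ (D.src e).val = v := by
  by_contra! hcon
  have : D.outdeg ⟨v, hv⟩ ≤ 1 := by
    refine Finset.card_le_one.2 fun a ha b hb => ?_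
    simp only [Finset.mem_filter, Finset.mem_univ, true_and, Fin.ext_iff] at ha hb
    have key : ∀ e, (D.src e).val = v → ∃ c, e = H c := fun e he => by
      by_contra! hc
      exact hcon e hc he
    obtain ⟨c, rfl⟩ := key a ha
    obtain ⟨c', rfl⟩ := key b hb
    have h1 := (hD.2.1 c).1
    have h2 := (hD.2.1 c').1
    congr 1
    exact Fin.ext (by omega)
  omega

lemma exists_extra_in {D : Multigraph m q} (H : Fin (m - 1) → Fin q)
    (hD : D.IsHamPathDigraph H) {v : ℕ} (hv : v < m) (hin : 2 ≤ D.indeg ⟨v, hv⟩) :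
    ∃ e, (∀ c, e ≠ H c) ∧ (D.tgt e).val = v := by
  by_contra! hcon
  have : D.indeg ⟨v, hv⟩ ≤ 1 := by
    refine Finset.card_le_one.2 fun a ha b hb => ?_
    simp only [Finset.mem_filter, Finset.mem_univ, true_and, Fin.ext_iff] at ha hb
    have key : ∀ e, (D.tgt e).val = v → ∃ c, e = H c := fun e he => by
      by_contra! hc
      exact hcon e hc he
    obtain ⟨c, rfl⟩ := key a ha
    obtain ⟨c', rfl⟩ := key b hb
    have h1 := (hD.2.1 c).2
    have h2 := (hD.2.1 c').2
    congr 1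
    exact Fin.ext (by omega)
  omega

lemma length_le_outdeg {D : Multigraph m q} (l : List (Fin q)) (hl : l.Nodup) {v : ℕ}
    (hv : v < m) (h : ∀ e ∈ l, (D.src e).val = v) : l.length ≤ D.outdeg ⟨v, hv⟩ := by
  rw [← List.toFinset_card_of_nodup hl]
  refine Finset.card_le_card fun e he => ?_
  simpa [Fin.ext_iff] using h e (List.mem_toFinset.1 he)

lemma length_le_indeg {D : Multigraph m q} (l : List (Fin q)) (hl : l.Nodup) {v : ℕ}
    (hv : v < m) (h : ∀ e ∈ l, (D.tgt e).val = v) : l.length ≤ D.indeg ⟨v, hv⟩ := by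
  rw [← List.toFinset_card_of_nodup hl]
  refine Finset.card_le_card fun e he => ?_
  simpa [Fin.ext_iff] using h e (List.mem_toFinset.1 he)

section LocalStructure

variable {D : Multigraph m q} {H : Fin (m - 1) → Fin q}

lemma eq_of_tgt_of_outdeg (hD : D.IsHamPathDigraph H) (hreg : D.ThreeRegular) {v : ℕ}
    (hv : v + 1 < m) (hout : 2 ≤ D.outdeg ⟨v + 1, hv⟩) {e : Fin q}
    (he : (D.tgt e).val = v + 1) : e = H ⟨v, by omega⟩ := by
  by_contra hne
  have := hreg ⟨v + 1, hv⟩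
  have h2 := length_le_indeg (D := D) [e, H ⟨v, by omega⟩] (by simpa using hne) hv (by
    simpa [he] using (hD.2.1 ⟨v, by omega⟩).2)
  simp only [List.length_cons, List.length_nil] at h2
  omega

lemma eq_of_src_of_outdeg (hD : D.IsHamPathDigraph H) (hreg : D.ThreeRegular) {v : ℕ}
    (hv : v + 2 < m) {e e' : Fin q} (hc' : ∀ c, e' ≠ H c)
    (he' : (D.src e').val = v + 1) (hc : ∀ c, e ≠ H c) (he : (D.src e).val = v + 1) :
    e = e' := by
  by_contra hne
  have := hreg ⟨v + 1, by omega⟩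
  have h2 := length_le_outdeg (D := D) [e, e', H ⟨v + 1, by omega⟩]
    (by simp [hne, hc, hc']) (v := v + 1) (by omega) (by
    simpa [he, he'] using (hD.2.1 ⟨v + 1, by omega⟩).1)
  have h3 := length_le_indeg (D := D) [H ⟨v, by omega⟩] (by simp) (v := v + 1) (by omega) (by
    simpa using (hD.2.1 ⟨v, by omega⟩).2)
  simp only [List.length_cons, List.length_nil] at h2 h3
  omega

lemma eq_of_tgt_of_indeg (hD : D.IsHamPathDigraph H) (hreg : D.ThreeRegular) {v : ℕ}
    (hv : v + 2 < m) {e e' : Fin q} (hc' : ∀ c, e' ≠ H c)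
    (he' : (D.tgt e').val = v + 1) (hc : ∀ c, e ≠ H c) (he : (D.tgt e).val = v + 1) :
    e = e' := by
  by_contra hne
  have := hreg ⟨v + 1, by omega⟩
  have h2 := length_le_indeg (D := D) [e, e', H ⟨v, by omega⟩]
    (by simp [hne, hc, hc']) (v := v + 1) (by omega) (by
    simpa [he, he'] using (hD.2.1 ⟨v, by omega⟩).2)
  have h3 := length_le_outdeg (D := D) [H ⟨v + 1, by omega⟩] (by simp) (v := v + 1) (by omega)
    (by simpa using (hD.2.1 ⟨v + 1, by omega⟩).1)
  simp only [List.length_cons, List.length_nil] at h2 h3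
  omega

lemma eq_of_src_of_outdeg_le (hD : D.IsHamPathDigraph H) {v : ℕ}
    (hv : v + 1 < m) (hout : D.outdeg ⟨v, by omega⟩ ≤ 1) {e : Fin q}
    (he : (D.src e).val = v) : e = H ⟨v, by omega⟩ := by
  by_contra hne
  have h2 := length_le_outdeg (D := D) [e, H ⟨v, by omega⟩] (by simpa using hne)
    (v := v) (by omega) (by simpa [he] using (hD.2.1 ⟨v, by omega⟩).1)
  simp only [List.length_cons, List.length_nil] at h2
  omega

/-- In a three-edge-connected digraph, an out-vertex and a following in-vertex are not joined by
two edges. -/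
lemma no_double_edge (hD : D.IsHamPathDigraph H) (hc : D.CutThree) {k : ℕ} (hk : k + 3 < m)
    {eu : Fin q} (hu : ∀ c, eu ≠ H c) (hsu : (D.src eu).val = k + 1)
    (htu : (D.tgt eu).val = k + 2)
    (hother : ∀ e, (∀ c, e ≠ H c) → e ≠ eu →
      ((D.src e).val ≠ k + 1 ∧ (D.src e).val ≠ k + 2) ∧
        (D.tgt e).val ≠ k + 1 ∧ (D.tgt e).val ≠ k + 2) : False := by
  have h3 := hc (fun v => decide (v.val = k + 1 ∨ v.val = k + 2))
    ⟨⟨k, by omega⟩, ⟨k + 1, by omega⟩, by simp⟩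
  rw [cut_eq_card] at h3
  have h2 := Finset.card_le_card (s := Finset.univ.filter (fun e =>
      decide ((D.src e).val = k + 1 ∨ (D.src e).val = k + 2) ≠
      decide ((D.tgt e).val = k + 1 ∨ (D.tgt e).val = k + 2)))
    (t := {H ⟨k, by omega⟩, H ⟨k + 2, by omega⟩}) fun e he => by
      simp only [Finset.mem_filter, Finset.mem_univ, true_and, ne_eq, decide_eq_decide] at he
      simp only [Finset.mem_insert, Finset.mem_singleton]
      by_cases hce : ∃ c, e = H c
      · obtain ⟨c, rfl⟩ := hce
        have := hD.2.1 c
        simp only [hD.1.eq_iff, Fin.ext_iff]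
        omega
      · push Not at hce
        by_cases heu : e = eu
        · subst heu
          omega
        · have := hother e hce heu
          omega
  have := (h3.trans h2).trans Finset.card_le_two
  omega

lemma SwapData.exists_gt {k : ℕ} {es et eu : Fin q} (h : D.SwapData H k es et eu)
    (hD : D.IsHamPathDigraph H) (hreg : D.ThreeRegular) (hc : D.CutThree) {f : Fin m → ℕ}
    (hm : 0 < m) (hf : D.IsCount ⟨0, hm⟩ f) :
    ∃ D' : Multigraph m q, D'.IsHamPathDigraph H ∧ D'.ThreeRegular ∧ D'.EdgeConnected 3 ∧
      f ⟨m - 1, by omega⟩ < D'.mu ⟨0, hm⟩ ⟨m - 1, by omega⟩ :=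
  ⟨D.swap k h.lt es et eu, h.isHam hD, h.threeRegular hreg,
    (h.cutThree hD hc).edgeConnected (by have := h.lt; omega),
    h.lt_count hD hm hf (isCount_mu (h.isHam hD).2.2 _)⟩

lemma exists_gt_of_outdeg (hD : D.IsHamPathDigraph H) (hreg : D.ThreeRegular)
    (hconn : D.EdgeConnected 3) {l : ℕ} (hl : l + 3 < m) (h0 : 2 ≤ D.outdeg ⟨l, by omega⟩)
    (h1 : 2 ≤ D.outdeg ⟨l + 1, by omega⟩) (h2 : 2 ≤ D.outdeg ⟨l + 2, by omega⟩)
    (h3 : D.outdeg ⟨l + 3, hl⟩ ≤ 1) (hm : 0 < m) :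
    ∃ D' : Multigraph m q, D'.IsHamPathDigraph H ∧ D'.ThreeRegular ∧ D'.EdgeConnected 3 ∧
      D.mu ⟨0, hm⟩ ⟨m - 1, by omega⟩ < D'.mu ⟨0, hm⟩ ⟨m - 1, by omega⟩ := by
  have hf : D.IsCount ⟨0, hm⟩ (D.mu ⟨0, hm⟩) := isCount_mu hD.2.2 _
  have t1 : ∀ e, (D.tgt e).val = l + 1 → e = H ⟨l, by omega⟩ := fun e he =>
    eq_of_tgt_of_outdeg hD hreg (by omega) h1 he
  have t2 : ∀ e, (D.tgt e).val = l + 2 → e = H ⟨l + 1, by omega⟩ := fun e he =>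
    eq_of_tgt_of_outdeg hD hreg (by omega) h2 he
  obtain ⟨ex, hx, hsx⟩ := exists_extra_out H hD _ h0
  obtain ⟨ev, hv, hsv⟩ := exists_extra_out H hD _ h1
  obtain ⟨ew, hw, hsw⟩ := exists_extra_out H hD _ h2
  have tge : ∀ e, (∀ c, e ≠ H c) → l ≤ (D.src e).val → l + 3 ≤ (D.tgt e).val := by
    intro e he hle
    have := hD.2.2 e
    have := mt (t1 e) (he _)
    have := mt (t2 e) (he _)
    omega
  have hvx : ev ≠ ex := by
    rintro rfl
    omega
  have hvw : ev ≠ ew := by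
    rintro rfl
    omega
  have hxw : ex ≠ ew := by
    rintro rfl
    omega
  have gx := tge ex hx (by omega)
  have gv := tge ev hv (by omega)
  have gw := tge ew hw (by omega)
  by_cases hlast : l + 4 = m
  · have h4 := length_le_indeg (D := D) [ex, ev, ew, H ⟨l + 2, by omega⟩]
      (by simp [hvx.symm, hvw, hxw, hx, hv, hw]) hl (by
        have := (hD.2.1 ⟨l + 2, by omega⟩).2
        simp only [List.mem_cons, List.not_mem_nil, or_false]
        rintro e (rfl | rfl | rfl | rfl) <;> omega)
    have := hreg ⟨l + 3, hl⟩
    simp only [List.length_cons, List.length_nil] at h4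
    omega
  obtain ⟨eu, hu, htu⟩ := exists_extra_in H hD hl (by have := hreg ⟨l + 3, hl⟩; omega)
  have s1 : ∀ e, (∀ c, e ≠ H c) → (D.src e).val = l + 1 → e = ev := fun e he h =>
    eq_of_src_of_outdeg hD hreg (by omega) hv hsv he h
  have s2 : ∀ e, (∀ c, e ≠ H c) → (D.src e).val = l + 2 → e = ew := fun e he h =>
    eq_of_src_of_outdeg hD hreg (by omega) hw hsw he h
  have s3 : ∀ e, (∀ c, e ≠ H c) → (D.src e).val ≠ l + 3 := fun e he h =>
    he _ (eq_of_src_of_outdeg_le hD (by omega) h3 h)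
  have t3 : ∀ e, (∀ c, e ≠ H c) → (D.tgt e).val = l + 3 → e = eu := fun e he h =>
    eq_of_tgt_of_indeg hD hreg (by omega) hu htu he h
  have hout : ∀ e, (∀ c, e ≠ H c) → e ≠ ev → e ≠ ew → e ≠ eu → D.Outside (l + 1) e := by
    intro e he nv nw nu
    have := mt (s1 e he) nv
    have := mt (s2 e he) nw
    have := s3 e he
    have := mt (t1 e) (he _)
    have := mt (t2 e) (he _)
    have := mt (t3 e he) nu
    unfold Outside
    omega
  have hsu := hD.2.2 eu
  by_cases huw : (D.src eu).val = l + 2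
  · refine (no_double_edge hD hconn.cutThree (k := l + 1) (by omega) hu huw htu
      fun e he nu => ?_).elim
    have hwu := s2 eu hu huw
    have := mt (s2 e he) (hwu ▸ nu)
    have := s3 e he
    have := mt (t2 e) (he _)
    have := mt (t3 e he) nu
    exact ⟨⟨by omega, by omega⟩, by omega, by omega⟩
  have huw' : ew ≠ eu := by
    rintro rfl
    exact huw hsw
  have gw' := mt (t3 ew hw) huw'
  by_cases huv : (D.src eu).val = l + 1
  · have hvu := s1 eu hu huv
    have hxu : ex ≠ eu := by
      rintro rfl
      omega
    have gx' := mt (t3 ex hx) hxu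
    have hT : D.TriangleData H (l + 1) ex eu ew :=
      ⟨by omega, by omega, hx, hu, hw, by omega, huv, by omega, by omega, htu, by omega,
        fun e he _ nu nw => hout e he (hvu ▸ nu) nw nu⟩
    obtain ⟨es, et, hS⟩ := hT.exists_swapData
    have hfe := hf.eq_pred hD hm l (by omega) t1
    exact hS.exists_gt (hT.isHam hD) (hT.threeRegular hreg) (hT.cutThree hD hconn.cutThree) hm
      (hT.isCount hf hfe)
  have huv' : ev ≠ eu := by
    rintro rfl
    exact huv hsv
  have gv' := mt (t3 ev hv) huv'
  rcases le_total (D.tgt ev).val (D.tgt ew).val with hle | hle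
  · have hS : D.SwapData H (l + 1) ev ew eu :=
      ⟨by omega, by omega, hv, hw, hu, hvw, Or.inl ⟨hsv, hsw⟩, by omega, hle, by omega, htu,
        hout⟩
    exact hS.exists_gt hD hreg hconn.cutThree hm hf
  · have hS : D.SwapData H (l + 1) ew ev eu :=
      ⟨by omega, by omega, hw, hv, hu, hvw.symm, Or.inr ⟨hsw, hsv⟩, by omega, hle, by omega,
        htu, fun e he h h' => hout e he h' h⟩
    exact hS.exists_gt hD hreg hconn.cutThree hm hf

/-- A digraph with three consecutive vertices of outdegree at least two does not maximize the
number of source-to-sink paths. -/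
lemma exists_gt_of_three_consecutive (hD : D.IsHamPathDigraph H) (hreg : D.ThreeRegular)
    (hconn : D.EdgeConnected 3) {a : ℕ} (ha : a + 2 < m) (h0 : 2 ≤ D.outdeg ⟨a, by omega⟩)
    (h1 : 2 ≤ D.outdeg ⟨a + 1, by omega⟩) (h2 : 2 ≤ D.outdeg ⟨a + 2, ha⟩) (hm : 0 < m) :
    ∃ D' : Multigraph m q, D'.IsHamPathDigraph H ∧ D'.ThreeRegular ∧ D'.EdgeConnected 3 ∧
      D.mu ⟨0, hm⟩ ⟨m - 1, by omega⟩ < D'.mu ⟨0, hm⟩ ⟨m - 1, by omega⟩ := by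
  induction hr : m - a using Nat.strong_induction_on generalizing a with
  | _ r ih =>
    by_cases hlast : a + 3 = m
    · obtain ⟨e, -, he⟩ := exists_extra_out H hD _ h2
      have := hD.2.2 e
      omega
    by_cases h3 : 2 ≤ D.outdeg ⟨a + 3, by omega⟩
    · exact ih (m - (a + 1)) (by omega) (a := a + 1) (by omega) h1 h2 h3 rfl
    · exact exists_gt_of_outdeg hD hreg hconn (by omega) h0 h1 h2 (by omega) hm

end LocalStructure

end Multigraph

/-- A 3-regular, 3-edge connected Hamiltonian-path digraph on `{1, …, 2n}`
maximizing the number of source-to-sink paths among all such digraphs has no three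
consecutive vertices of outdegree at least 2, and no three consecutive vertices of
indegree at least 2. (Vertices are 0-based: `Fin (2n)`.) -/
theorem maximizer_no_three_consecutive (n q : ℕ) (hn : 1 ≤ n)
    (D : Multigraph (2 * n) q) (H : Fin (2 * n - 1) → Fin q)
    (hD : D.IsHamPathDigraph H) (hreg : D.ThreeRegular) (hconn : D.EdgeConnected 3)
    (hmax : ∀ (q' : ℕ) (D' : Multigraph (2 * n) q') (H' : Fin (2 * n - 1) → Fin q'),
      D'.IsHamPathDigraph H' → D'.ThreeRegular → D'.EdgeConnected 3 →
      ¬ (D.mu ⟨0, by omega⟩ ⟨2 * n - 1, by omega⟩ <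
          D'.mu ⟨0, by omega⟩ ⟨2 * n - 1, by omega⟩)) :
    (¬ ∃ a : ℕ, ∃ h : a + 2 < 2 * n,
      2 ≤ D.outdeg ⟨a, by omega⟩ ∧ 2 ≤ D.outdeg ⟨a + 1, by omega⟩ ∧
      2 ≤ D.outdeg ⟨a + 2, by omega⟩) ∧
    (¬ ∃ a : ℕ, ∃ h : a + 2 < 2 * n,
      2 ≤ D.indeg ⟨a, by omega⟩ ∧ 2 ≤ D.indeg ⟨a + 1, by omega⟩ ∧
      2 ≤ D.indeg ⟨a + 2, by omega⟩) := by
  refine ⟨fun ⟨a, ha, h0, h1, h2⟩ => ?_, fun ⟨a, ha, h0, h1, h2⟩ => ?_⟩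
  · obtain ⟨D', h3, h4, h5, h6⟩ :=
      Multigraph.exists_gt_of_three_consecutive hD hreg hconn ha h0 h1 h2 (by omega)
    exact hmax q D' H h3 h4 h5 h6
  · have hrev : ∀ b (hb : b < 2 * n), (⟨b, hb⟩ : Fin (2 * n)).rev = ⟨2 * n - 1 - b, by omega⟩ :=
      fun b hb => Fin.ext (by simp only [Fin.val_rev]; omega)
    have hdeg : ∀ b c (hb : b < 2 * n) (hc : c < 2 * n), b + c + 1 = 2 * n →
        D.reverse.outdeg ⟨b, hb⟩ = D.indeg ⟨c, hc⟩ := fun b c hb hc hbc => by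
      rw [Multigraph.outdeg_reverse, hrev]
      congr 1
      exact Fin.ext (by simp only; omega)
    obtain ⟨D', h3, h4, h5, h6⟩ :=
      Multigraph.exists_gt_of_three_consecutive (a := 2 * n - 3 - a) hD.reverse hreg.reverse
        hconn.reverse (by omega)
        (by rwa [hdeg _ (a + 2) _ (by omega) (by omega)])
        (by rwa [hdeg _ (a + 1) _ (by omega) (by omega)])
        (by rwa [hdeg _ a _ (by omega) (by omega)]) (by omega)
    refine hmax q D'.reverse _ h3.reverse h4.reverse h5.reverse ?_
    have hmu : ∀ E : Multigraph (2 * n) q,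
        E.reverse.mu ⟨0, by omega⟩ ⟨2 * n - 1, by omega⟩ =
          E.mu ⟨0, by omega⟩ ⟨2 * n - 1, by omega⟩ := fun E => by
      have := E.mu_reverse ⟨0, by omega⟩ ⟨2 * n - 1, by omega⟩
      rw [hrev, hrev] at this
      simpa using this
    rw [hmu]
    rwa [hmu] at h6
end

section
/- For every integer n ≥ 1, every 3-regular, 2-edge connected, acyclic finite directed multigraph on 2n vertices with a unique source and a unique sink has at most 2^n + 1 source-to-sink paths. -/
namespace Multigraph

open Finset

variable {m q : ℕ} {D : Multigraph m q}

/-- `p` is a directed path from `s` to `w`, or the empty path if `w = s`. -/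
def IsWalk (D : Multigraph m q) (s w : Fin m) (p : List (Fin q)) : Prop :=
  (p = [] ∧ w = s) ∨ D.IsPath s w p

theorem IsPath.ne_nil {u v : Fin m} {p : List (Fin q)} (h : D.IsPath u v p) : p ≠ [] := by
  obtain ⟨⟨e, r, rfl, -⟩, -⟩ := h
  simp

theorem isPath_append_singleton_iff {s v : Fin m} {p : List (Fin q)} {e : Fin q} :
    D.IsPath s v (p ++ [e]) ↔ D.tgt e = v ∧ D.IsWalk s (D.src e) p := by
  constructor
  · rintro ⟨⟨a, r, har, ha⟩, ⟨b, r', hbr, hb⟩, hc⟩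
    obtain ⟨rfl, hbe⟩ := List.append_inj' hbr rfl
    obtain rfl : e = b := by simpa using hbe
    refine ⟨hb, ?_⟩
    rcases List.eq_nil_or_concat p with rfl | ⟨p', c, rfl⟩
    · left
      simp only [List.nil_append, List.cons.injEq] at har
      exact ⟨rfl, by rw [har.1, ha]⟩
    · right
      have hc' := List.isChain_append.1 hc
      refine ⟨?_, ⟨c, p', by simp, hc'.2.2 c (by simp) e (by simp)⟩, hc'.1⟩
      cases p' with
      | nil =>
        simp only [List.concat_eq_append, List.nil_append, List.cons_append,
          List.cons.injEq] at har
        exact ⟨c, [], by simp, by rw [har.1, ha]⟩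
      | cons d p'' =>
        simp only [List.concat_eq_append, List.cons_append, List.cons.injEq] at har
        exact ⟨d, p'' ++ [c], by simp, by rw [har.1, ha]⟩
  · rintro ⟨rfl, ⟨rfl, h⟩ | ⟨⟨a, r, rfl, ha⟩, ⟨b, r', hbr, hb⟩, hc⟩⟩
    · exact ⟨⟨e, [], rfl, h⟩, ⟨e, [], rfl, rfl⟩, List.isChain_singleton _⟩
    · refine ⟨⟨a, r ++ [e], by simp, ha⟩, ⟨e, a :: r, rfl, rfl⟩, ?_⟩
      refine List.isChain_append.2 ⟨hc, List.isChain_singleton _, ?_⟩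
      intro x hx y hy
      rw [hbr] at hx
      simp only [List.getLast?_append, List.getLast?_singleton, Option.some_or,
        Option.mem_def, Option.some.injEq, List.head?_cons] at hx hy
      rw [← hx, ← hy, hb]

theorem card_isWalk (hacy : D.Acyclic) (s v : Fin m) :
    Nat.card {p // D.IsWalk s v p} = D.mu s v := by
  unfold mu
  split_ifs with h
  · subst h
    have : ∀ p, D.IsWalk v v p ↔ p = [] := fun p =>
      ⟨fun hp => hp.elim And.left fun hp => (hacy v ⟨p, hp⟩).elim, fun hp => .inl ⟨hp, rfl⟩⟩
    simp [this]
  · simp [IsWalk, h, pathCount]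

theorem exists_order (hacy : D.Acyclic) :
    ∃ f : Fin m → ℕ, Function.Injective f ∧ ∀ e, f (D.src e) < f (D.tgt e) := by
  classical
  let A : Fin m → Finset (Fin m) := fun v => univ.filter fun u => ∃ p, D.IsPath u v p
  have hA : ∀ e, #(A (D.src e)) < #(A (D.tgt e)) := by
    intro e
    refine card_lt_card ⟨fun u hu => ?_, fun h => ?_⟩
    · simp only [A, mem_filter_univ] at hu ⊢
      obtain ⟨p, hp⟩ := hu
      exact ⟨p ++ [e], isPath_append_singleton_iff.2 ⟨rfl, .inr hp⟩⟩
    · have : D.src e ∈ A (D.tgt e) := by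
        simp only [A, mem_filter_univ]
        exact ⟨[] ++ [e], isPath_append_singleton_iff.2 ⟨rfl, .inl ⟨rfl, rfl⟩⟩⟩
      exact hacy _ (by simpa [A] using h this)
  refine ⟨fun v => v + m * #(A v), fun u v huv => ?_, fun e => ?_⟩
  · have h := congrArg (· % m) huv
    simp only [Nat.add_mul_mod_self_left, Nat.mod_eq_of_lt u.2, Nat.mod_eq_of_lt v.2] at h
    exact Fin.ext h
  · have h1 := Nat.mul_le_mul_left m (hA e)
    have h2 := (D.src e).2
    simp only [Nat.succ_eq_add_one, mul_add, mul_one] at h1 ⊢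
    omega

/-- Appending an edge into `v` to a walk ending at its source. -/
def appendEdge (D : Multigraph m q) (s v : Fin m) :
    (Σ e : {e // D.tgt e = v}, {p // D.IsWalk s (D.src e) p}) → {p // D.IsWalk s v p} :=
  fun x => ⟨x.2.1 ++ [x.1.1], .inr (isPath_append_singleton_iff.2 ⟨x.1.2, x.2.2⟩)⟩

theorem appendEdge_bijective {s v : Fin m} (hv : v ≠ s) :
    Function.Bijective (D.appendEdge s v) := by
  constructor
  · rintro ⟨⟨e, he⟩, p, hp⟩ ⟨⟨e', he'⟩, p', hp'⟩ h
    obtain ⟨rfl, h2⟩ := List.append_inj' (congrArg Subtype.val h) rfl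
    obtain rfl : e = e' := by simpa using h2
    rfl
  · rintro ⟨p, hp⟩
    rcases List.eq_nil_or_concat p with rfl | ⟨p, e, rfl⟩
    · rcases hp with hp | hp
      · exact (hv hp.2).elim
      · exact (hp.ne_nil rfl).elim
    · rw [List.concat_eq_append] at hp
      obtain ⟨h1, h2⟩ := isPath_append_singleton_iff.1 (hp.resolve_left (by simp))
      exact ⟨⟨⟨e, h1⟩, p, h2⟩, by simp [appendEdge]⟩

theorem finite_isWalk (hacy : D.Acyclic) (s v : Fin m) : Finite {p // D.IsWalk s v p} := by
  obtain ⟨f, -, hf⟩ := exists_order hacy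
  induction hk : f v using Nat.strong_induction_on generalizing v with
  | _ k ih =>
    subst hk
    by_cases hv : v = s
    · subst hv
      refine (Set.finite_singleton ([] : List (Fin q))).subset fun p hp => ?_
      exact hp.elim And.left fun hp => (hacy v ⟨p, hp⟩).elim
    · have : ∀ e : {e // D.tgt e = v}, Finite {p // D.IsWalk s (D.src e) p} := fun e =>
        ih _ ((hf e).trans_eq (congrArg f e.2)) _ rfl
      exact Finite.of_surjective _ (appendEdge_bijective hv).2

theorem mu_eq_sum (hacy : D.Acyclic) {s v : Fin m} (hv : v ≠ s) :
    D.mu s v = ∑ e with D.tgt e = v, D.mu s (D.src e) := by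
  have := fun e : {e // D.tgt e = v} => finite_isWalk hacy s (D.src e)
  rw [← card_isWalk hacy, ← Nat.card_eq_of_bijective _ (appendEdge_bijective hv), Nat.card_sigma]
  simp only [card_isWalk hacy]
  exact (sum_subtype _ (by simp) fun e => D.mu s (D.src e)).symm

theorem mu_self (s : Fin m) : D.mu s s = 1 := if_pos rfl

theorem sum_outdeg (P : Finset (Fin m)) :
    ∑ u ∈ P, D.outdeg u = #{e | D.src e ∈ P} := by
  rw [card_eq_sum_card_fiberwise (f := D.src) (t := P) (by intro e; simp)]
  refine sum_congr rfl fun u hu => congrArg card ?_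
  ext e
  simp only [mem_filter, mem_univ, true_and]
  exact ⟨fun h => ⟨h ▸ hu, h⟩, And.right⟩

theorem sum_indeg (P : Finset (Fin m)) :
    ∑ u ∈ P, D.indeg u = #{e | D.tgt e ∈ P} := by
  rw [card_eq_sum_card_fiberwise (f := D.tgt) (t := P) (by intro e; simp)]
  refine sum_congr rfl fun u hu => congrArg card ?_
  ext e
  simp only [mem_filter, mem_univ, true_and]
  exact ⟨fun h => ⟨h ▸ hu, h⟩, And.right⟩

theorem EdgeConnected.two_le_card_cut (hconn : D.EdgeConnected 2) {P : Finset (Fin m)}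
    {a b : Fin m} (ha : a ∈ P) (hb : b ∉ P) (hP : ∀ e, D.tgt e ∈ P → D.src e ∈ P) :
    2 ≤ #{e | D.src e ∈ P ∧ D.tgt e ∉ P} := by
  by_contra! hlt
  have h := hconn.2 {e | D.src e ∈ P ∧ D.tgt e ∉ P} (by omega) a b (by rintro rfl; exact hb ha)
  refine hb ?_
  clear hb
  induction h with
  | refl => exact ha
  | tail _ h ih =>
    obtain ⟨e, he, ⟨rfl, rfl⟩ | ⟨rfl, rfl⟩⟩ := h
    · by_contra hn
      exact he (by simp [ih, hn])
    · exact hP e ih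

theorem UniqueSource.apply_le {f : Fin m → ℕ} (hf : ∀ e, f (D.src e) < f (D.tgt e))
    {s : Fin m} (hs : D.UniqueSource s) (v : Fin m) : f s ≤ f v := by
  obtain ⟨w, -, hw⟩ := exists_min_image univ f ⟨v, mem_univ v⟩
  have : w = s := hs.2 w <| by
    refine card_eq_zero.2 (filter_eq_empty_iff.2 fun e _ he => ?_)
    have := hw (D.src e) (mem_univ _)
    have := hf e
    rw [he] at this
    omega
  exact this ▸ hw v (mem_univ v)

theorem UniqueSink.le_apply {f : Fin m → ℕ} (hf : ∀ e, f (D.src e) < f (D.tgt e))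
    {t : Fin m} (ht : D.UniqueSink t) (v : Fin m) : f v ≤ f t := by
  obtain ⟨w, -, hw⟩ := exists_max_image univ f ⟨v, mem_univ v⟩
  have : w = t := ht.2 w <| by
    refine card_eq_zero.2 (filter_eq_empty_iff.2 fun e _ he => ?_)
    have := hw (D.tgt e) (mem_univ _)
    have := hf e
    rw [he] at this
    omega
  exact this ▸ hw v (mem_univ v)

/-- The four kinds of vertices in a 3-regular digraph with a unique source and sink. -/
theorem vertex_cases (hreg : D.ThreeRegular) {s t : Fin m} (hs : D.UniqueSource s)
    (ht : D.UniqueSink t) (v : Fin m) :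
    (v = s ∧ v ≠ t ∧ D.indeg v = 0 ∧ D.outdeg v = 3) ∨
    (v ≠ s ∧ v = t ∧ D.indeg v = 3 ∧ D.outdeg v = 0) ∨
    (v ≠ s ∧ v ≠ t ∧ D.indeg v = 1 ∧ D.outdeg v = 2) ∨
    (v ≠ s ∧ v ≠ t ∧ D.indeg v = 2 ∧ D.outdeg v = 1) := by
  have h := hreg v
  have h1 : v = s ↔ D.indeg v = 0 := ⟨fun h => h ▸ hs.1, hs.2 v⟩
  have h2 : v = t ↔ D.outdeg v = 0 := ⟨fun h => h ▸ ht.1, ht.2 v⟩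
  simp only [ne_eq, h1, h2]
  omega

theorem sum_outdeg_add_card (hreg : D.ThreeRegular) {s t : Fin m} (hs : D.UniqueSource s)
    (ht : D.UniqueSink t) (P : Finset (Fin m)) :
    ∑ u ∈ P, D.outdeg u + #{u ∈ P | D.indeg u = 2} + (if t ∈ P then 3 else 0) =
      ∑ u ∈ P, D.indeg u + #{u ∈ P | D.indeg u = 1} + (if s ∈ P then 3 else 0) := by
  simp only [card_filter, ← sum_ite_eq' P _ fun _ => 3, ← sum_add_distrib]
  refine sum_congr rfl fun u _ => ?_
  rcases vertex_cases hreg hs ht u with ⟨h1, h2, h3, h4⟩ | ⟨h1, h2, h3, h4⟩ | ⟨h1, h2, h3, h4⟩ |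
    ⟨h1, h2, h3, h4⟩ <;> simp only [h3, h4] <;> split_ifs <;> first | contradiction | omega

theorem card_indeg_one (hreg : D.ThreeRegular) {s t : Fin m} (hs : D.UniqueSource s)
    (ht : D.UniqueSink t) : 2 * #{u | D.indeg u = 1} + 2 = m := by
  have h1 := sum_outdeg_add_card hreg hs ht univ
  simp only [sum_outdeg, sum_indeg, mem_univ, filter_true, if_true] at h1
  have h2 : ∑ u : Fin m, ((if u = s then 1 else 0) + (if u = t then 1 else 0) +
      (if D.indeg u = 1 then 1 else 0) + (if D.indeg u = 2 then 1 else 0)) =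
      ∑ u : Fin m, 1 := by
    refine sum_congr rfl fun u _ => ?_
    rcases vertex_cases hreg hs ht u with ⟨h1, h2, h3, -⟩ | ⟨h1, h2, h3, -⟩ | ⟨h1, h2, h3, -⟩ |
      ⟨h1, h2, h3, -⟩ <;> simp only [h3] <;> split_ifs <;> first | contradiction | omega
  simp only [sum_add_distrib, ← card_filter, sum_ite_eq', mem_univ, if_true, sum_const, card_univ,
    Fintype.card_fin, smul_eq_mul, mul_one] at h2
  omega

theorem mu_sink_eq (hreg : D.ThreeRegular) (hacy : D.Acyclic) {s t : Fin m}
    (hs : D.UniqueSource s) (ht : D.UniqueSink t) :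
    D.mu s t = ∑ v with D.indeg v = 1, D.mu s v + 3 := by
  have h1 : ∑ v, D.mu s v * D.outdeg v + 1 = ∑ v, D.mu s v := by
    have h : ∀ v, D.mu s v = ∑ e with D.tgt e = v, D.mu s (D.src e) + if v = s then 1 else 0 := by
      intro v
      split_ifs with hv
      · subst hv
        have : (univ.filter fun e => D.tgt e = v) = ∅ := card_eq_zero.1 hs.1
        rw [this, mu_self, sum_empty]
      · rw [mu_eq_sum hacy hv, add_zero]
    rw [sum_congr rfl fun v _ => h v, sum_add_distrib, sum_fiberwise, sum_ite_eq',
      if_pos (mem_univ s), ← sum_fiberwise univ D.src fun e => D.mu s (D.src e)]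
    congr 1
    refine sum_congr rfl fun v _ => ?_
    rw [sum_congr rfl (g := fun _ => D.mu s v) fun e he => by rw [(mem_filter.1 he).2],
      sum_const, smul_eq_mul, mul_comm]
    rfl
  have h2 : ∑ v, (D.mu s v * D.outdeg v + if v = t then D.mu s t else 0) =
      ∑ v, (D.mu s v + (if D.indeg v = 1 then D.mu s v else 0) + if v = s then 2 else 0) := by
    refine sum_congr rfl fun v _ => ?_
    rcases vertex_cases hreg hs ht v with ⟨h1, h2, h3, h4⟩ | ⟨h1, h2, h3, h4⟩ |
      ⟨h1, h2, h3, h4⟩ | ⟨h1, h2, h3, h4⟩ <;>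
      simp only [h3, h4]
    · subst h1
      simp [h2, mu_self]
    · subst h2
      simp [h1]
    · simp [h1, h2, mul_two]
    · simp [h1, h2]
  simp only [sum_add_distrib, sum_ite_eq', mem_univ, if_true, ← sum_filter] at h2
  omega

theorem mu_le_two_pow (hreg : D.ThreeRegular) (hacy : D.Acyclic) {s t : Fin m}
    (hs : D.UniqueSource s) (ht : D.UniqueSink t) {f : Fin m → ℕ}
    (hf : ∀ e, f (D.src e) < f (D.tgt e)) (v : Fin m) (hv : v ≠ t) :
    D.mu s v ≤ 2 ^ #{u | f u ≤ f v ∧ D.indeg u = 2} := by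
  induction hk : f v using Nat.strong_induction_on generalizing v with
  | _ k ih =>
    subst hk
    by_cases hvs : v = s
    · rw [hvs, mu_self]
      exact Nat.one_le_two_pow
    have key : ∀ e ∈ ({e | D.tgt e = v} : Finset (Fin q)),
        D.mu s (D.src e) ≤ 2 ^ #{u | f u < f v ∧ D.indeg u = 2} := by
      intro e he
      obtain rfl := (mem_filter.1 he).2
      refine (ih _ (hf e) (D.src e) ?_ rfl).trans ?_
      · intro h
        exact absurd (UniqueSink.le_apply hf ht (D.tgt e)) (by rw [← h]; exact (hf e).not_ge)
      · refine Nat.pow_le_pow_right two_pos (card_le_card ?_)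
        exact monotone_filter_right _ fun u _ hu => ⟨hu.1.trans_lt (hf e), hu.2⟩
    have hsum : D.mu s v ≤ D.indeg v * 2 ^ #{u | f u < f v ∧ D.indeg u = 2} := by
      rw [mu_eq_sum hacy hvs]
      exact sum_le_card_nsmul _ _ _ key
    have hsub : ({u | f u < f v ∧ D.indeg u = 2} : Finset (Fin m)) ⊆
        ({u | f u ≤ f v ∧ D.indeg u = 2} : Finset (Fin m)) :=
      monotone_filter_right _ fun u _ hu => ⟨hu.1.le, hu.2⟩
    rcases vertex_cases hreg hs ht v with h | h | h | h
    · exact absurd h.1 hvs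
    · exact absurd h.2.1 hv
    · rw [h.2.2.1, one_mul] at hsum
      exact hsum.trans (Nat.pow_le_pow_right two_pos (card_le_card hsub))
    · rw [h.2.2.1, ← pow_succ'] at hsum
      refine hsum.trans (Nat.pow_le_pow_right two_pos (card_lt_card ⟨hsub, fun hc => ?_⟩))
      have := @hc v (by simp [h.2.2.1])
      simp at this

theorem card_indeg_two_le (hreg : D.ThreeRegular) (hconn : D.EdgeConnected 2) {s t : Fin m}
    (hs : D.UniqueSource s) (ht : D.UniqueSink t) {f : Fin m → ℕ}
    (hinj : Function.Injective f) (hf : ∀ e, f (D.src e) < f (D.tgt e)) {v : Fin m}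
    (hv : D.indeg v = 1) :
    #{u | f u ≤ f v ∧ D.indeg u = 2} ≤ #{u | f u ≤ f v ∧ D.indeg u = 1} := by
  have hvs : v ≠ s := by rintro rfl; exact absurd hs.1 (by omega)
  let P : Finset (Fin m) := {u | f u < f v}
  have hsP : s ∈ P := by
    have := UniqueSource.apply_le hf hs v
    have := hinj.ne hvs
    simp only [P, mem_filter_univ]
    omega
  have htP : t ∉ P := by
    have := UniqueSink.le_apply hf ht v
    simp only [P, mem_filter_univ]
    omega
  have hP : ∀ e, D.tgt e ∈ P → D.src e ∈ P := by
    intro e he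
    simp only [P, mem_filter_univ] at he ⊢
    exact (hf e).trans he
  have h1 := sum_outdeg_add_card hreg hs ht P
  have h2 := hconn.two_le_card_cut hsP htP hP
  have h3 : #{e | D.src e ∈ P} = #{e | D.tgt e ∈ P} + #{e | D.src e ∈ P ∧ D.tgt e ∉ P} := by
    rw [← card_filter_add_card_filter_not (s := {e | D.src e ∈ P}) fun e => D.tgt e ∈ P,
      filter_filter, filter_filter]
    congr 2
    ext e
    simpa using hP e
  rw [sum_outdeg, sum_indeg, if_neg htP, if_pos hsP, h3] at h1
  have h4 : ({u | f u ≤ f v ∧ D.indeg u = 2} : Finset (Fin m)) ⊆ {u ∈ P | D.indeg u = 2} := by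
    intro u hu
    simp only [P, mem_filter, mem_univ, true_and] at hu ⊢
    refine ⟨hu.1.lt_of_ne fun h => ?_, hu.2⟩
    rw [hinj h] at hu
    omega
  have h5 : insert v ({u ∈ P | D.indeg u = 1} : Finset (Fin m)) ⊆
      ({u | f u ≤ f v ∧ D.indeg u = 1} : Finset (Fin m)) := by
    intro u hu
    simp only [P, mem_insert, mem_filter, mem_univ, true_and] at hu ⊢
    rcases hu with rfl | hu
    · exact ⟨le_rfl, hv⟩
    · exact ⟨hu.1.le, hu.2⟩
  have h6 := card_le_card h4
  have h7 := card_le_card h5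
  rw [card_insert_of_notMem (by simp [P])] at h7
  omega

end Multigraph

/-- The elements of a finite set have ranks `1, …, #S`, so the powers of two they index sum to
`2 ^ (#S + 1) - 2`. -/
theorem Finset.sum_two_pow_rank (S : Finset ℕ) :
    ∑ a ∈ S, 2 ^ (S.filter (· ≤ a)).card + 2 = 2 ^ (S.card + 1) := by
  induction S using Finset.induction_on_max with
  | empty => simp
  | insert a S ha ih =>
    have hn : a ∉ S := fun h => (ha a h).false
    rw [sum_insert hn, card_insert_of_notMem hn]
    have h1 : (insert a S).filter (· ≤ a) = insert a S :=
      filter_true_of_mem fun x hx => (mem_insert.1 hx).elim le_of_eq fun h => (ha x h).le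
    have h2 : ∀ x ∈ S, (insert a S).filter (· ≤ x) = S.filter (· ≤ x) := fun x hx => by
      rw [filter_insert, if_neg (ha x hx).not_ge]
    rw [h1, card_insert_of_notMem hn, sum_congr rfl fun x hx => by rw [h2 x hx], add_assoc, ih,
      ← two_mul, ← pow_succ']

/-- For `n ≥ 1`, every 3-regular, 2-edge connected, acyclic finite directed
multigraph on `2n` vertices with a unique source and a unique sink has at most `2 ^ n + 1`
source-to-sink paths. -/
theorem twoEdgeConnected_upper_bound (n : ℕ) (hn : 1 ≤ n) (q : ℕ)
    (D : Multigraph (2 * n) q) (s t : Fin (2 * n)) (hreg : D.ThreeRegular)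
    (hconn : D.EdgeConnected 2) (hacy : D.Acyclic)
    (hs : D.UniqueSource s) (ht : D.UniqueSink t) :
    D.mu s t ≤ 2 ^ n + 1 := by
  obtain ⟨f, hinj, hf⟩ := Multigraph.exists_order hacy
  have hcard := Multigraph.card_indeg_one hreg hs ht
  have hrank := Finset.sum_two_pow_rank
    ((Finset.univ.filter fun v => D.indeg v = 1).map ⟨f, hinj⟩)
  simp only [Finset.sum_map, Finset.filter_map, Finset.card_map, Function.Embedding.coeFn_mk,
    Finset.filter_filter] at hrank
  rw [show (Finset.univ.filter fun v => D.indeg v = 1).card + 1 = n by omega] at hrank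
  rw [Multigraph.mu_sink_eq hreg hacy hs ht, ← hrank]
  suffices h : ∀ v ∈ Finset.univ.filter (fun v => D.indeg v = 1), D.mu s v ≤
      2 ^ (Finset.univ.filter
        (fun u => D.indeg u = 1 ∧ ((fun x => x ≤ f v) ∘ f) u)).card by
    have := Finset.sum_le_sum h
    exact Nat.add_le_add_right this 3
  intro v hv
  have hv1 := (Finset.mem_filter.1 hv).2
  have hvt : v ≠ t := by
    rintro rfl
    have := hreg v
    have := ht.1
    omega
  refine (Multigraph.mu_le_two_pow hreg hacy hs ht hf v hvt).trans
    (Nat.pow_le_pow_right two_pos ?_)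
  refine (Multigraph.card_indeg_two_le hreg hconn hs ht hinj hf hv1).trans (Finset.card_le_card ?_)
  exact Finset.monotone_filter_right _ fun u _ hu => ⟨hu.2, hu.1⟩
end

section
/- For every integer n ≥ 1, there exists a 3-regular, 2-edge connected, acyclic finite directed multigraph on 2n vertices with a unique source and a unique sink having exactly 2^n + 1 source-to-sink paths. -/
namespace Multigraph

variable {m q : ℕ}

/-- The directed walks from `s` to `v`, including the empty walk when `v = s`. -/
def walks (D : Multigraph m q) (s v : Fin m) : Set (List (Fin q)) :=
  {p | (p = [] ∧ v = s) ∨ D.IsPath s v p}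

theorem isPath_iff (D : Multigraph m q) (u v : Fin m) (p : List (Fin q)) :
    D.IsPath u v p ↔ (∃ e rest, p = e :: rest ∧ D.src e = u) ∧
      (∃ e rest, p = rest ++ [e] ∧ D.tgt e = v) ∧
      p.IsChain (fun a b => D.tgt a = D.src b) :=
  Iff.rfl

theorem not_isPath_nil (D : Multigraph m q) (u v : Fin m) : ¬ D.IsPath u v [] := by
  rintro ⟨⟨e, r, h, -⟩, -⟩
  simp at h

theorem nil_mem_walks (D : Multigraph m q) (s v : Fin m) :
    [] ∈ D.walks s v ↔ v = s := by
  simp [walks, not_isPath_nil]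

theorem append_singleton_mem_walks (D : Multigraph m q) (s v : Fin m) (p : List (Fin q))
    (e : Fin q) : p ++ [e] ∈ D.walks s v ↔ D.tgt e = v ∧ p ∈ D.walks s (D.src e) := by
  rcases List.eq_nil_or_concat' p with rfl | ⟨r, f, rfl⟩
  · rw [nil_mem_walks]
    simp only [walks, isPath_iff, Set.mem_ofPred_eq]
    constructor
    · rintro (⟨h, -⟩ | ⟨⟨a, l, h, h1⟩, ⟨b, l', h', h2⟩, -⟩)
      · simp at h
      · obtain ⟨-, h'⟩ := List.append_inj' h' rfl
        simp at h h'
        obtain ⟨rfl, -⟩ := h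
        subst h'
        exact ⟨h2, h1⟩
    · rintro ⟨h1, h2⟩
      exact Or.inr ⟨⟨e, [], rfl, h2⟩, ⟨e, [], rfl, h1⟩, by simp⟩
  · simp only [walks, isPath_iff, Set.mem_ofPred_eq]
    constructor
    · rintro (⟨h, -⟩ | ⟨⟨a, l, h, h1⟩, ⟨b, l', h', h2⟩, h3⟩)
      · simp at h
      · obtain ⟨-, h'⟩ := List.append_inj' h' rfl
        simp at h'
        subst h'
        rw [List.isChain_append] at h3
        obtain ⟨h3, -, h4⟩ := h3
        refine ⟨h2, Or.inr ⟨?_, ⟨f, r, rfl, h4 f (by simp) e (by simp)⟩, h3⟩⟩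
        cases r with
        | nil => simp at h; exact ⟨f, [], rfl, h.1 ▸ h1⟩
        | cons x r => simp at h; exact ⟨x, r ++ [f], rfl, h.1 ▸ h1⟩
    · rintro ⟨h1, ⟨h, -⟩ | ⟨⟨a, l, h, h2⟩, ⟨b, l', h', h3⟩, h4⟩⟩
      · simp at h
      · obtain ⟨-, h'⟩ := List.append_inj' h' rfl
        simp at h'
        subst h'
        refine Or.inr ⟨⟨a, l ++ [e], by rw [h]; rfl, h2⟩, ⟨e, _, rfl, h1⟩, ?_⟩
        rw [List.isChain_append]
        refine ⟨h4, by simp, ?_⟩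
        simpa using h3

theorem mem_walks_of_ne (D : Multigraph m q) {s v : Fin m} (h : v ≠ s) (p : List (Fin q)) :
    p ∈ D.walks s v ↔ ∃ e r, D.tgt e = v ∧ r ∈ D.walks s (D.src e) ∧ r ++ [e] = p := by
  constructor
  · intro hp
    rcases List.eq_nil_or_concat' p with rfl | ⟨r, f, rfl⟩
    · exact absurd ((D.nil_mem_walks s v).1 hp) h
    · obtain ⟨h1, h2⟩ := (D.append_singleton_mem_walks s v r f).1 hp
      exact ⟨f, r, h1, h2, rfl⟩
  · rintro ⟨e, r, h1, h2, rfl⟩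
    exact (D.append_singleton_mem_walks s v r e).2 ⟨h1, h2⟩

theorem encard_walks (D : Multigraph m q) {s v : Fin m} (h : v ≠ s) :
    (D.walks s v).encard =
      ∑ e ∈ Finset.univ.filter (fun e => D.tgt e = v), (D.walks s (D.src e)).encard := by
  have key : ∀ A : Finset (Fin q),
      {p | ∃ e r, e ∈ A ∧ r ∈ D.walks s (D.src e) ∧ r ++ [e] = p}.encard =
        ∑ e ∈ A, (D.walks s (D.src e)).encard := by
    intro A
    induction A using Finset.induction_on with
    | empty => simp
    | insert a A ha ih =>
      rw [Finset.sum_insert ha, ← ih,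
        ← Function.Injective.encard_image (f := fun r => r ++ [a])
          (List.append_left_injective [a]) (D.walks s (D.src a)),
        ← Set.encard_union_eq]
      · congr 1
        ext p
        simp [or_and_right, exists_or]
      · rw [Set.disjoint_left]
        rintro _ ⟨r, -, rfl⟩ ⟨e, r', he, -, h⟩
        obtain ⟨-, h⟩ := List.append_inj' (t₁ := [e]) (t₂ := [a]) h rfl
        simp at h
        exact ha (h ▸ he)
  rw [← key]
  congr 1
  ext p
  rw [D.mem_walks_of_ne h]
  simp

theorem le_of_mem_walks (D : Multigraph m q) (hD : ∀ e, D.src e < D.tgt e) {s : Fin m}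
    (p : List (Fin q)) : ∀ v, p ∈ D.walks s v → s ≤ v ∧ (p ≠ [] → s < v) := by
  induction p using List.reverseRecOn with
  | nil =>
    intro v h
    rw [nil_mem_walks] at h
    simp [h]
  | append_singleton r e ih =>
    intro v h
    rw [append_singleton_mem_walks] at h
    obtain ⟨rfl, h⟩ := h
    have := (ih _ h).1.trans_lt (hD e)
    exact ⟨this.le, fun _ => this⟩

theorem acyclic_of_src_lt_tgt (D : Multigraph m q) (hD : ∀ e, D.src e < D.tgt e) :
    D.Acyclic := by
  rintro v ⟨p, hp⟩
  refine lt_irrefl v ((D.le_of_mem_walks hD p v (Or.inr hp)).2 ?_)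
  rintro rfl
  exact D.not_isPath_nil v v hp

theorem walks_self (D : Multigraph m q) (hD : ∀ e, D.src e < D.tgt e) (s : Fin m) :
    D.walks s s = {[]} := by
  ext p
  constructor
  · intro h
    by_contra hp
    exact lt_irrefl s ((D.le_of_mem_walks hD p s h).2 hp)
  · rintro rfl
    exact (D.nil_mem_walks s s).2 rfl

theorem mu_eq_ncard_walks (D : Multigraph m q) {s v : Fin m} (h : v ≠ s) :
    D.mu s v = (D.walks s v).ncard := by
  rw [mu, if_neg h, pathCount, ← Nat.card_coe_set_eq]
  simp only [walks, h, and_false, false_or]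
  rfl

/-- The path `0 → 1 → ⋯ → 2n-1` with every edge `2i → 2i+1` doubled, together with an
edge `0 → 2n-1`. The edges `0, …, 2n-2` form the path, the edge `2n-1` joins its ends, and
the edges `2n, …, 3n-1` are the additional parallel edges. -/
def doubledPath (n : ℕ) : Multigraph (2 * n) (3 * n) where
  src e := ⟨if e.1 < 2 * n - 1 then e.1 else if e.1 = 2 * n - 1 then 0 else 2 * (e.1 - 2 * n),
    by split_ifs <;> omega⟩
  tgt e := ⟨if e.1 < 2 * n - 1 then e.1 + 1 else if e.1 = 2 * n - 1 then 2 * n - 1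
    else 2 * (e.1 - 2 * n) + 1, by split_ifs <;> omega⟩

namespace doubledPath

variable {n : ℕ}

theorem src_lt_tgt (e : Fin (3 * n)) : (doubledPath n).src e < (doubledPath n).tgt e := by
  simp only [doubledPath, Fin.mk_lt_mk]
  split_ifs <;> omega

theorem filter_tgt_zero (hn : 0 < 2 * n) :
    Finset.univ.filter (fun e => (doubledPath n).tgt e = ⟨0, hn⟩) = ∅ := by
  ext e
  simp only [doubledPath, Finset.mem_filter, Finset.mem_univ, true_and, Fin.ext_iff,
    Finset.notMem_empty, iff_false]
  intro h
  split_ifs at h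
  omega

theorem filter_tgt_even (i : ℕ) (hi : 2 * i + 2 < 2 * n) :
    Finset.univ.filter (fun e => (doubledPath n).tgt e = ⟨2 * i + 2, hi⟩) =
      {⟨2 * i + 1, by omega⟩} := by
  ext e
  simp only [doubledPath, Finset.mem_filter, Finset.mem_univ, true_and, Fin.ext_iff,
    Finset.mem_singleton]
  split_ifs <;> omega

theorem filter_tgt_odd (i : ℕ) (hi : 2 * i + 2 < 2 * n) :
    Finset.univ.filter (fun e => (doubledPath n).tgt e = ⟨2 * i + 1, by omega⟩) =
      {⟨2 * i, by omega⟩, ⟨2 * n + i, by omega⟩} := by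
  ext e
  simp only [doubledPath, Finset.mem_filter, Finset.mem_univ, true_and, Fin.ext_iff,
    Finset.mem_singleton, Finset.mem_insert]
  split_ifs <;> omega

theorem filter_tgt_last (hn : 1 ≤ n) :
    Finset.univ.filter (fun e => (doubledPath n).tgt e = ⟨2 * n - 1, by omega⟩) =
      {⟨2 * n - 2, by omega⟩, ⟨2 * n - 1, by omega⟩, ⟨3 * n - 1, by omega⟩} := by
  ext e
  simp only [doubledPath, Finset.mem_filter, Finset.mem_univ, true_and, Fin.ext_iff,
    Finset.mem_singleton, Finset.mem_insert]
  split_ifs <;> omega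

theorem filter_src_zero (hn : 1 ≤ n) :
    Finset.univ.filter (fun e => (doubledPath n).src e = ⟨0, by omega⟩) =
      {⟨0, by omega⟩, ⟨2 * n - 1, by omega⟩, ⟨2 * n, by omega⟩} := by
  ext e
  simp only [doubledPath, Finset.mem_filter, Finset.mem_univ, true_and, Fin.ext_iff,
    Finset.mem_singleton, Finset.mem_insert]
  split_ifs <;> omega

theorem filter_src_odd (i : ℕ) (hi : 2 * i + 2 < 2 * n) :
    Finset.univ.filter (fun e => (doubledPath n).src e = ⟨2 * i + 1, by omega⟩) =
      {⟨2 * i + 1, by omega⟩} := by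
  ext e
  simp only [doubledPath, Finset.mem_filter, Finset.mem_univ, true_and, Fin.ext_iff,
    Finset.mem_singleton]
  split_ifs <;> (try rw [false_iff]) <;> omega

theorem filter_src_even (i : ℕ) (hi : 2 * i + 2 < 2 * n) :
    Finset.univ.filter (fun e => (doubledPath n).src e = ⟨2 * i + 2, hi⟩) =
      {⟨2 * i + 2, by omega⟩, ⟨2 * n + i + 1, by omega⟩} := by
  ext e
  simp only [doubledPath, Finset.mem_filter, Finset.mem_univ, true_and, Fin.ext_iff,
    Finset.mem_singleton, Finset.mem_insert]
  split_ifs <;> (try rw [false_iff]) <;> omega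

theorem filter_src_last (hn : 1 ≤ n) :
    Finset.univ.filter (fun e => (doubledPath n).src e = ⟨2 * n - 1, by omega⟩) = ∅ := by
  ext e
  simp only [doubledPath, Finset.mem_filter, Finset.mem_univ, true_and, Fin.ext_iff,
    Finset.notMem_empty, iff_false]
  intro h
  split_ifs at h <;> omega

theorem vertex_cases (hn : 1 ≤ n) (v : Fin (2 * n)) :
    v = ⟨0, by omega⟩ ∨ v = ⟨2 * n - 1, by omega⟩ ∨
      ∃ (i : ℕ) (hi : 2 * i + 2 < 2 * n), v = ⟨2 * i + 1, by omega⟩ ∨ v = ⟨2 * i + 2, hi⟩ := by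
  simp only [Fin.ext_iff]
  by_cases h0 : v.1 = 0
  · exact Or.inl h0
  by_cases h1 : v.1 = 2 * n - 1
  · exact Or.inr (Or.inl h1)
  exact Or.inr (Or.inr ⟨(v.1 - 1) / 2, by omega, by omega⟩)

theorem indeg_zero (hn : 1 ≤ n) : (doubledPath n).indeg ⟨0, by omega⟩ = 0 := by
  rw [indeg, filter_tgt_zero, Finset.card_empty]

theorem indeg_odd (i : ℕ) (hi : 2 * i + 2 < 2 * n) :
    (doubledPath n).indeg ⟨2 * i + 1, by omega⟩ = 2 := by
  rw [indeg, filter_tgt_odd i hi, Finset.card_pair]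
  simp only [ne_eq, Fin.ext_iff]
  omega

theorem indeg_even (i : ℕ) (hi : 2 * i + 2 < 2 * n) :
    (doubledPath n).indeg ⟨2 * i + 2, hi⟩ = 1 := by
  rw [indeg, filter_tgt_even i hi, Finset.card_singleton]

theorem indeg_last (hn : 1 ≤ n) : (doubledPath n).indeg ⟨2 * n - 1, by omega⟩ = 3 := by
  rw [indeg, filter_tgt_last hn, Finset.card_eq_three]
  refine ⟨_, _, _, ?_, ?_, ?_, rfl⟩ <;> simp only [ne_eq, Fin.ext_iff] <;> omega

theorem outdeg_zero (hn : 1 ≤ n) : (doubledPath n).outdeg ⟨0, by omega⟩ = 3 := by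
  rw [outdeg, filter_src_zero hn, Finset.card_eq_three]
  refine ⟨_, _, _, ?_, ?_, ?_, rfl⟩ <;> simp only [ne_eq, Fin.ext_iff] <;> omega

theorem outdeg_odd (i : ℕ) (hi : 2 * i + 2 < 2 * n) :
    (doubledPath n).outdeg ⟨2 * i + 1, by omega⟩ = 1 := by
  rw [outdeg, filter_src_odd i hi, Finset.card_singleton]

theorem outdeg_even (i : ℕ) (hi : 2 * i + 2 < 2 * n) :
    (doubledPath n).outdeg ⟨2 * i + 2, hi⟩ = 2 := by
  rw [outdeg, filter_src_even i hi, Finset.card_pair]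
  simp only [ne_eq, Fin.ext_iff]
  omega

theorem outdeg_last (hn : 1 ≤ n) : (doubledPath n).outdeg ⟨2 * n - 1, by omega⟩ = 0 := by
  rw [outdeg, filter_src_last hn, Finset.card_empty]

theorem threeRegular (hn : 1 ≤ n) : (doubledPath n).ThreeRegular := by
  intro v
  rcases vertex_cases hn v with rfl | rfl | ⟨i, hi, rfl | rfl⟩
  · rw [indeg_zero hn, outdeg_zero hn]
  · rw [indeg_last hn, outdeg_last hn]
  · rw [indeg_odd i hi, outdeg_odd i hi]
  · rw [indeg_even i hi, outdeg_even i hi]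

theorem uniqueSource (hn : 1 ≤ n) : (doubledPath n).UniqueSource ⟨0, by omega⟩ := by
  refine ⟨indeg_zero hn, fun v hv => ?_⟩
  rcases vertex_cases hn v with rfl | rfl | ⟨i, hi, rfl | rfl⟩
  · rfl
  · simp [indeg_last hn] at hv
  · simp [indeg_odd i hi] at hv
  · simp [indeg_even i hi] at hv

theorem uniqueSink (hn : 1 ≤ n) : (doubledPath n).UniqueSink ⟨2 * n - 1, by omega⟩ := by
  refine ⟨outdeg_last hn, fun v hv => ?_⟩
  rcases vertex_cases hn v with rfl | rfl | ⟨i, hi, rfl | rfl⟩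
  · simp [outdeg_zero hn] at hv
  · rfl
  · simp [outdeg_odd i hi] at hv
  · simp [outdeg_even i hi] at hv

theorem encard_walks_even_step (i : ℕ) (hi : 2 * i + 2 < 2 * n) :
    ((doubledPath n).walks ⟨0, by omega⟩ ⟨2 * i + 2, hi⟩).encard =
      2 * ((doubledPath n).walks ⟨0, by omega⟩ ⟨2 * i, by omega⟩).encard := by
  have h1 : (doubledPath n).src ⟨2 * i + 1, by omega⟩ = ⟨2 * i + 1, by omega⟩ := by
    simp only [doubledPath, Fin.ext_iff]; split_ifs <;> omega
  have h2 : (doubledPath n).src ⟨2 * i, by omega⟩ = ⟨2 * i, by omega⟩ := by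
    simp only [doubledPath, Fin.ext_iff]; split_ifs <;> omega
  have h3 : (doubledPath n).src ⟨2 * n + i, by omega⟩ = ⟨2 * i, by omega⟩ := by
    simp only [doubledPath, Fin.ext_iff]; split_ifs <;> omega
  rw [encard_walks _ (by simp), filter_tgt_even i hi, Finset.sum_singleton, h1,
    encard_walks _ (by simp), filter_tgt_odd i hi, Finset.sum_pair, h2, h3, ← two_mul]
  simp only [ne_eq, Fin.ext_iff]
  omega

theorem encard_walks_even (i : ℕ) (hi : 2 * i < 2 * n) :
    ((doubledPath n).walks ⟨0, by omega⟩ ⟨2 * i, hi⟩).encard = 2 ^ i := by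
  induction i with
  | zero =>
    simp only [Nat.mul_zero, walks_self _ src_lt_tgt, Set.encard_singleton, pow_zero]
  | succ i ih =>
    rw [pow_succ', ← ih (by omega)]
    exact encard_walks_even_step i hi

theorem encard_walks_last (hn : 1 ≤ n) :
    ((doubledPath n).walks ⟨0, by omega⟩ ⟨2 * n - 1, by omega⟩).encard = 2 ^ n + 1 := by
  have h1 : (doubledPath n).src ⟨2 * n - 2, by omega⟩ = ⟨2 * (n - 1), by omega⟩ := by
    simp only [doubledPath, Fin.ext_iff]; split_ifs <;> omega
  have h2 : (doubledPath n).src ⟨2 * n - 1, by omega⟩ = ⟨0, by omega⟩ := by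
    simp only [doubledPath, Fin.ext_iff]; split_ifs <;> omega
  have h3 : (doubledPath n).src ⟨3 * n - 1, by omega⟩ = ⟨2 * (n - 1), by omega⟩ := by
    simp only [doubledPath, Fin.ext_iff]; split_ifs <;> omega
  rw [encard_walks _ (by simp only [ne_eq, Fin.ext_iff]; omega), filter_tgt_last hn,
    Finset.sum_insert, Finset.sum_pair, h1, h2, h3, encard_walks_even,
    walks_self _ src_lt_tgt, Set.encard_singleton, add_comm 1, ← add_assoc, ← two_mul,
    ← pow_succ', Nat.sub_add_cancel hn]
  · simp only [ne_eq, Fin.ext_iff]; omega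
  · simp only [Finset.mem_insert, Finset.mem_singleton, Fin.ext_iff]; omega

theorem mu_last (hn : 1 ≤ n) :
    (doubledPath n).mu ⟨0, by omega⟩ ⟨2 * n - 1, by omega⟩ = 2 ^ n + 1 := by
  rw [mu_eq_ncard_walks _ (by simp only [ne_eq, Fin.ext_iff]; omega), Set.ncard,
    encard_walks_last hn]
  rfl

theorem reflTransGen_adj_of_le (S : Set (Fin (3 * n))) {a b : ℕ} (hab : a ≤ b)
    (hb : b < 2 * n) (h : ∀ i (_ : a ≤ i) (_ : i < b), (⟨i, by omega⟩ : Fin (3 * n)) ∈ S) :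
    Relation.ReflTransGen ((doubledPath n).Adj S) ⟨a, by omega⟩ ⟨b, hb⟩ := by
  induction b, hab using Nat.le_induction with
  | base => exact .refl
  | succ b hab ih =>
    refine (ih (by omega) fun i h1 h2 => h i h1 (by omega)).tail
      ⟨⟨b, by omega⟩, h b hab (by omega), Or.inl ⟨?_, ?_⟩⟩ <;>
    · simp only [doubledPath, Fin.ext_iff]
      split_ifs <;> omega

theorem adj_symm {m q : ℕ} (D : Multigraph m q) (S : Set (Fin q)) : Std.Symm (D.Adj S) := by
  refine ⟨?_⟩
  rintro a b ⟨e, he, h⟩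
  exact ⟨e, he, h.symm⟩

theorem edgeConnected_two (hn : 1 ≤ n) : (doubledPath n).EdgeConnected 2 := by
  refine ⟨by omega, fun F hF => ?_⟩
  have hF' := Finset.card_le_one.1 hF
  have := adj_symm (doubledPath n) {e | e ∉ F}
  have hsymm {a b : Fin (2 * n)} :
      Relation.ReflTransGen ((doubledPath n).Adj {e | e ∉ F}) a b →
        Relation.ReflTransGen ((doubledPath n).Adj {e | e ∉ F}) b a :=
    Relation.ReflTransGen.stdSymm.symm a b
  suffices h : ∀ v : Fin (2 * n),
      Relation.ReflTransGen ((doubledPath n).Adj {e | e ∉ F}) ⟨0, by omega⟩ v from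
    fun a b _ => (hsymm (h a)).trans (h b)
  intro v
  by_cases h : ∃ (i : ℕ) (hi : i < v.1), (⟨i, by omega⟩ : Fin (3 * n)) ∈ F
  · obtain ⟨i, hi, hiF⟩ := h
    have hmem : ∀ j (hj : j < 3 * n), i < j → (⟨j, hj⟩ : Fin (3 * n)) ∉ F := by
      intro j hj hij hjF
      have := Fin.ext_iff.1 (hF' _ hiF _ hjF)
      simp only at this
      omega
    refine .head ⟨⟨2 * n - 1, by omega⟩, hmem _ _ (by omega), Or.inl ⟨?_, ?_⟩⟩
      (hsymm (reflTransGen_adj_of_le _ (b := 2 * n - 1) (by omega : v.1 ≤ _) (by omega)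
        fun j h1 _ => hmem j _ (by omega)))
    all_goals
      simp only [doubledPath, Fin.ext_iff]
      split_ifs <;> omega
  · push Not at h
    exact reflTransGen_adj_of_le _ (Nat.zero_le _) v.2 fun i _ hi => h i hi

end doubledPath

end Multigraph

/-- For every `n ≥ 1` the bound `2 ^ n + 1` is attained by some 3-regular,
2-edge connected, acyclic finite directed multigraph on `2n` vertices with a unique
source and a unique sink. -/
theorem twoEdgeConnected_bound_tight (n : ℕ) (hn : 1 ≤ n) :
    ∃ (q : ℕ) (D : Multigraph (2 * n) q) (s t : Fin (2 * n)),
      D.ThreeRegular ∧ D.EdgeConnected 2 ∧ D.Acyclic ∧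
      D.UniqueSource s ∧ D.UniqueSink t ∧ D.mu s t = 2 ^ n + 1 := by
  open Multigraph in
  exact ⟨3 * n, doubledPath n, ⟨0, by omega⟩, ⟨2 * n - 1, by omega⟩,
    doubledPath.threeRegular hn, doubledPath.edgeConnected_two hn,
    acyclic_of_src_lt_tgt _ doubledPath.src_lt_tgt, doubledPath.uniqueSource hn,
    doubledPath.uniqueSink hn, doubledPath.mu_last hn⟩
end
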